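/- Let x > 0. Then there exist a constant C > 0 and k₀ ∈ ℕ such that for all k ≥ k₀: −(π/(4k))·f(x)/√(f(x)²−1) − C/k² ≤ j_{xk,k}/k − ι(x) ≤ −(π/(4k))·f(x)/√(f(x)²−1) + C/k². -/

import Mathlib

open Real Set Filter

/-- The Bessel function of the first kind,
`J_ν(x) = Σ_{n=0}^∞ ((−1)ⁿ/(n!·Γ(n+ν+1)))·(x/2)^{2n+ν}`. -/
noncomputable def besselJ (ν x : ℝ) : ℝ :=
  ∑' n : ℕ, ((-1 : ℝ)^n / ((n.factorial : ℝ) * Real.Gamma ((n : ℝ) + ν + 1)))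
    * (x/2) ^ (2*(n:ℝ) + ν)

/-- The function `y ↦ π/(√(y²−1) − arccos(1/y))`, a strictly decreasing bijection
from `(1,∞)` onto `(0,∞)`. -/
noncomputable def sigmaF (y : ℝ) : ℝ :=
  Real.pi / (Real.sqrt (y^2 - 1) - Real.arccos (1/y))

-- SECTION A
/-- The entire series with `J_ν(t) = (t/2)^ν bS ν (t²/4)`. -/
noncomputable def bC (ν : ℝ) (n : ℕ) : ℝ := 1 / ((n.factorial : ℝ) * Real.Gamma ((n : ℝ) + ν + 1))

noncomputable def bS (ν u : ℝ) : ℝ := ∑' n : ℕ, bC ν n * (-u)^n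

lemma gamma_shift_ge (ν : ℝ) (hν : 0 ≤ ν) (n : ℕ) :
    Real.Gamma (ν + 1) ≤ Real.Gamma ((n : ℝ) + ν + 1) := by
  induction n with
  | zero => simp
  | succ n ih =>
    have h1 : ((n + 1 : ℕ) : ℝ) + ν + 1 = ((n : ℝ) + ν + 1) + 1 := by push_cast; ring
    have hpos : 0 < (n : ℝ) + ν + 1 := by positivity
    rw [h1, Real.Gamma_add_one hpos.ne']
    have hg : 0 < Real.Gamma ((n : ℝ) + ν + 1) := Real.Gamma_pos_of_pos hpos
    have h2 : 1 ≤ (n : ℝ) + ν + 1 := by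
      have : (0:ℝ) ≤ n := Nat.cast_nonneg n
      linarith
    nlinarith

lemma bC_nonneg (ν : ℝ) (hν : 0 ≤ ν) (n : ℕ) : 0 ≤ bC ν n := by
  unfold bC
  have hpos : 0 < (n : ℝ) + ν + 1 := by positivity
  have hg : 0 < Real.Gamma ((n : ℝ) + ν + 1) := Real.Gamma_pos_of_pos hpos
  positivity

lemma bC_le (ν : ℝ) (hν : 0 ≤ ν) (n : ℕ) :
    bC ν n ≤ (1 / Real.Gamma (ν + 1)) * (1 / (n.factorial : ℝ)) := by
  unfold bC
  have hg : 0 < Real.Gamma (ν + 1) := Real.Gamma_pos_of_pos (by positivity)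
  have h1 := gamma_shift_ge ν hν n
  rw [one_div_mul_one_div, mul_comm (Real.Gamma (ν+1))]
  gcongr

lemma bS_summable (ν : ℝ) (hν : 0 ≤ ν) (u : ℝ) : Summable (fun n : ℕ => bC ν n * (-u)^n) := by
  refine Summable.of_norm_bounded (g := fun n : ℕ => (1 / Real.Gamma (ν + 1)) * (|u| ^ n / (n.factorial : ℝ)))
    ((Real.summable_pow_div_factorial |u|).mul_left _) ?_
  intro n
  rw [norm_mul, norm_pow, Real.norm_eq_abs, Real.norm_eq_abs, abs_neg,
    abs_of_nonneg (bC_nonneg ν hν n)]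
  calc bC ν n * |u|^n ≤ ((1 / Real.Gamma (ν + 1)) * (1 / (n.factorial : ℝ))) * |u|^n := by
        gcongr; exact bC_le ν hν n
    _ = _ := by ring

lemma bC_succ (ν : ℝ) (n : ℕ) : ((n : ℝ) + 1) * bC ν (n + 1) = bC (ν + 1) n := by
  unfold bC
  rw [Nat.factorial_succ]
  have h : ((n + 1 : ℕ) : ℝ) + ν + 1 = (n : ℝ) + (ν + 1) + 1 := by push_cast; ring
  rw [h]
  push_cast
  have : (n : ℝ) + 1 ≠ 0 := by positivity
  have h2 : (n.factorial : ℝ) ≠ 0 := by positivity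
  field_simp

lemma bC_nu (ν : ℝ) (hν : 0 ≤ ν) (n : ℕ) : bC ν n = ((n : ℝ) + ν + 1) * bC (ν + 1) n := by
  unfold bC
  have h : (n : ℝ) + (ν + 1) + 1 = ((n : ℝ) + ν + 1) + 1 := by ring
  have hpos : 0 < (n : ℝ) + ν + 1 := by positivity
  rw [h, Real.Gamma_add_one hpos.ne']
  have hg : 0 < Real.Gamma ((n : ℝ) + ν + 1) := Real.Gamma_pos_of_pos hpos
  field_simp

lemma bS_hasDerivAt (ν : ℝ) (hν : 0 ≤ ν) (u : ℝ) : HasDerivAt (bS ν) (- bS (ν + 1) u) u := by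
  set R : ℝ := |u| + 1 with hR
  have key : HasDerivAt (fun z => ∑' n : ℕ, bC ν n * (-z)^n)
      (∑' n : ℕ, bC ν n * (-((n : ℝ) * (-u)^(n-1)))) u := by
    have hsum : Summable (fun n : ℕ => (1 / Real.Gamma (ν + 1)) * ((2 * R) ^ n / (n.factorial : ℝ))) :=
      (Real.summable_pow_div_factorial (2*R)).mul_left _
    refine hasDerivAt_tsum_of_isPreconnected (t := Metric.ball (0:ℝ) R) hsum Metric.isOpen_ball
      (convex_ball _ _).isPreconnected (g := fun n z => bC ν n * (-z)^n)
      (g' := fun n z => bC ν n * (-((n : ℝ) * (-z)^(n-1)))) ?_ ?_ (y₀ := 0) ?_ (bS_summable ν hν 0) ?_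
    · intro n z _
      have := ((hasDerivAt_id z).neg.pow n).const_mul (bC ν n)
      refine this.congr_deriv ?_
      simp
    · intro n z hz
      have hz' : |z| ≤ R := by
        have := mem_ball_zero_iff.1 hz
        rw [Real.norm_eq_abs] at this; exact this.le
      have hR1 : 1 ≤ R := by rw [hR]; linarith [abs_nonneg u]
      rw [norm_mul, norm_neg, norm_mul, norm_pow, Real.norm_eq_abs, Real.norm_eq_abs,
        Real.norm_eq_abs, abs_neg, abs_of_nonneg (bC_nonneg ν hν n), Nat.abs_cast]
      have h1 : (n : ℝ) ≤ 2 ^ n := by exact_mod_cast (Nat.lt_two_pow_self (n := n)).le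
      have h2 : |z| ^ (n-1) ≤ R ^ n := calc
        |z| ^ (n-1) ≤ R ^ (n-1) := by gcongr
        _ ≤ R ^ n := pow_le_pow_right₀ hR1 (by omega)
      calc bC ν n * (n * |z|^(n-1)) ≤ ((1 / Real.Gamma (ν + 1)) * (1 / (n.factorial : ℝ))) * (2^n * R^n) := by
            have := bC_nonneg ν hν n
            have h3 := bC_le ν hν n
            gcongr
        _ = _ := by rw [mul_pow]; ring
    · simp [hR]; positivity
    · simp [hR]
  have e : (∑' n : ℕ, bC ν n * (-((n : ℝ) * (-u)^(n-1)))) = - bS (ν + 1) u := by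
    have hs0 : Summable (fun n : ℕ => bC ν (n+1) * (-(((n+1 : ℕ) : ℝ) * (-u)^(n+1-1)))) := by
      have := (bS_summable (ν+1) (by positivity) u).neg
      refine this.congr ?_
      intro n
      rw [← bC_succ ν n]; push_cast; simp; ring
    have hs1 : Summable (fun n : ℕ => bC ν n * (-((n : ℝ) * (-u)^(n-1)))) :=
      (summable_nat_add_iff (f := fun n : ℕ => bC ν n * (-((n : ℝ) * (-u)^(n-1)))) 1).1 hs0
    rw [hs1.tsum_eq_zero_add]
    unfold bS
    rw [← tsum_neg]
    simp only [Nat.cast_zero, zero_mul, neg_zero, mul_zero, zero_add]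
    apply tsum_congr
    intro n
    rw [← bC_succ ν n]; push_cast; simp; ring
  rw [e] at key
  exact key

lemma bS_rec (ν : ℝ) (hν : 0 ≤ ν) (u : ℝ) :
    u * bS (ν + 2) u = (ν + 1) * bS (ν + 1) u - bS ν u := by
  have h1 := bS_summable (ν+1) (by positivity) u
  have h0 := bS_summable ν hν u
  have h2 := bS_summable (ν+2) (by positivity) u
  have e : (ν + 1) * bS (ν + 1) u - bS ν u
      = ∑' n : ℕ, (- (n : ℝ)) * bC (ν+1) n * (-u)^n := by
    unfold bS
    rw [← tsum_mul_left, ← (h1.mul_left (ν+1)).tsum_sub h0]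
    apply tsum_congr
    intro n
    rw [bC_nu ν hν n]; ring
  rw [e]
  have hs : Summable (fun n : ℕ => (- (n : ℝ)) * bC (ν+1) n * (-u)^n) := by
    refine ((h1.mul_left (ν+1)).sub h0).congr ?_
    intro n
    rw [bC_nu ν hν n]; ring
  rw [hs.tsum_eq_zero_add]
  unfold bS
  rw [← tsum_mul_left]
  simp only [Nat.cast_zero, neg_zero, zero_mul, zero_add]
  apply tsum_congr
  intro n
  have := bC_succ (ν+1) n
  have e2 : ν + 1 + 1 = ν + 2 := by ring
  rw [e2] at this
  rw [← this, pow_succ]; push_cast; ring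

lemma besselJ_eq (ν t : ℝ) (ht : 0 < t) :
    besselJ ν t = (t/2) ^ ν * bS ν (t^2/4) := by
  unfold besselJ bS
  rw [← tsum_mul_left]
  apply tsum_congr
  intro n
  have h2 : 0 < t/2 := by positivity
  rw [Real.rpow_add h2, mul_comm (2:ℝ) (n:ℝ), mul_comm (n:ℝ) (2:ℝ), Real.rpow_mul h2.le]
  have : (t/2)^(2:ℝ) = t^2/4 := by
    rw [show (2:ℝ) = ((2:ℕ):ℝ) by norm_num, Real.rpow_natCast]; norm_num; ring
  rw [this, Real.rpow_natCast]
  unfold bC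
  rw [neg_pow (t^2/4)]
  ring

/-- solutions of the modified Bessel equation on `(0,∞)` -/
def IsMSol (ν : ℝ) (M M1 : ℝ → ℝ) : Prop :=
  ∀ t : ℝ, 0 < t → HasDerivAt M (M1 t) t ∧ HasDerivAt M1 (-((2*ν+1)/t * M1 t) - M t) t

noncomputable def jM (ν t : ℝ) : ℝ := bS ν (t^2/4)
noncomputable def jM1 (ν t : ℝ) : ℝ := -(t/2) * bS (ν+1) (t^2/4)

lemma jM_sol (ν : ℝ) (hν : 0 ≤ ν) : IsMSol ν (jM ν) (jM1 ν) := by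
  intro t ht
  have hq : HasDerivAt (fun t : ℝ => t^2/4) (t/2) t := by
    have := (hasDerivAt_pow 2 t).div_const 4
    refine this.congr_deriv ?_
    simp; ring
  constructor
  · have := (bS_hasDerivAt ν hν (t^2/4)).comp t hq
    refine this.congr_deriv ?_
    unfold jM1; ring
  · have h1 := (bS_hasDerivAt (ν+1) (by positivity) (t^2/4)).comp t hq
    have h2 : HasDerivAt (fun t : ℝ => -(t/2)) (-(1/2)) t := ((hasDerivAt_id t).div_const 2).neg
    have := h2.mul h1
    refine this.congr_deriv ?_
    have r := bS_rec ν hν (t^2/4)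
    have e2 : ν + 1 + 1 = ν + 2 := by ring
    simp only [Function.comp, e2, jM, jM1]
    have : bS ν (t^2/4) = (ν + 1) * bS (ν + 1) (t^2/4) - t^2/4 * bS (ν + 2) (t^2/4) := by linarith
    rw [this]
    field_simp
    ring

lemma besselJ_zero_iff (ν t : ℝ) (ht : 0 < t) : besselJ ν t = 0 ↔ jM ν t = 0 := by
  rw [besselJ_eq ν t ht, jM]
  have : (t/2)^ν ≠ 0 := (Real.rpow_pos_of_pos (by positivity) _).ne'
  simp [this]

lemma bS_zero (ν : ℝ) : bS ν 0 = 1 / Real.Gamma (ν+1) := by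
  unfold bS
  rw [tsum_eq_single 0]
  · simp [bC]
  · intro n hn; simp [hn]

lemma jM_cont (ν : ℝ) (hν : 0 ≤ ν) : Continuous (jM ν) := by
  have : Continuous (bS ν) := continuous_iff_continuousAt.2 fun u => (bS_hasDerivAt ν hν u).continuousAt
  unfold jM
  fun_prop

lemma jM1_cont (ν : ℝ) (hν : 0 ≤ ν) : Continuous (jM1 ν) := by
  have : Continuous (bS (ν+1)) := continuous_iff_continuousAt.2 fun u =>
    (bS_hasDerivAt (ν+1) (by positivity) u).continuousAt
  unfold jM1
  fun_prop

lemma jM_zero_pos (ν : ℝ) (hν : 0 ≤ ν) : 0 < jM ν 0 := by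
  unfold jM
  have : 0 < Real.Gamma (ν + 1) := Real.Gamma_pos_of_pos (by positivity)
  norm_num [bS_zero]
  exact this

/-- zeros are simple -/
lemma msol_simple (ν : ℝ) (hν : 0 ≤ ν) (z : ℝ) (hz : 0 < z) (h0 : jM ν z = 0) : jM1 ν z ≠ 0 := by
  intro h1
  have hm : MonotoneOn (fun t : ℝ => t^(2*(2*ν+1)) * ((jM ν t)^2 + (jM1 ν t)^2)) (Ioi 0) := by
    have hd : ∀ t ∈ Ioi (0:ℝ), HasDerivAt (fun t : ℝ => t^(2*(2*ν+1)) * ((jM ν t)^2 + (jM1 ν t)^2))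
       (t^(2*(2*ν+1)) * (2*(2*ν+1)/t) * (jM ν t)^2) t := by
      intro t ht
      have ht : 0 < t := ht
      obtain ⟨d0, d1⟩ := jM_sol ν hν t ht
      have hp := Real.hasDerivAt_rpow_const (p := 2*(2*ν+1)) (Or.inl ht.ne')
      have := hp.mul ((d0.pow 2).add (d1.pow 2))
      refine this.congr_deriv ?_
      rw [Real.rpow_sub_one ht.ne']
      simp only [Pi.add_apply, Pi.pow_apply]
      field_simp
      push_cast
      ring
    apply monotoneOn_of_deriv_nonneg (convex_Ioi 0)
    · exact fun t ht => (hd t ht).continuousAt.continuousWithinAt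
    · intro t ht
      rw [interior_Ioi] at ht
      exact (hd t ht).differentiableAt.differentiableWithinAt
    · intro t ht
      rw [interior_Ioi] at ht
      rw [(hd t ht).deriv]
      have ht : 0 < t := ht
      positivity
  have hev : ∀ᶠ t in nhdsWithin (0:ℝ) (Ioi 0), 0 < jM ν t :=
    (((jM_cont ν hν).tendsto 0).eventually (lt_mem_nhds (jM_zero_pos ν hν))).filter_mono nhdsWithin_le_nhds
  have hev2 : ∀ᶠ t in nhdsWithin (0:ℝ) (Ioi 0), t < z :=
    (eventually_lt_nhds hz).filter_mono nhdsWithin_le_nhds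
  obtain ⟨t, h, htz, ht⟩ := (hev.and (hev2.and self_mem_nhdsWithin)).exists
  have := hm ht hz htz.le
  simp only [h0, h1] at this
  have ht : 0 < t := ht
  have hp : 0 < t^(2*(2*ν+1)) * ((jM ν t)^2 + (jM1 ν t)^2) := by positivity
  norm_num at this
  linarith

/-- A second solution `N` with `t^{2ν} N(t) → 0` at `0` vanishes at the zeros of `jM`. -/
lemma msol_zero_transfer (ν : ℝ) (hν : 0 < ν) (N N1 : ℝ → ℝ) (hN : IsMSol ν N N1)
    (hlim : Tendsto (fun t : ℝ => t^(2*ν) * N t) (nhdsWithin 0 (Ioi 0)) (nhds 0))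
    (z : ℝ) (hz : 0 < z) (h0 : jM ν z = 0) : N z = 0 := by
  set W : ℝ → ℝ := fun t => t^(2*ν+1) * (jM ν t * N1 t - jM1 ν t * N t) with hW
  have hWd : ∀ t ∈ Ioi (0:ℝ), HasDerivAt W 0 t := by
    intro t ht
    have ht : 0 < t := ht
    obtain ⟨d0, d1⟩ := jM_sol ν hν.le t ht
    obtain ⟨e0, e1⟩ := hN t ht
    have hp := Real.hasDerivAt_rpow_const (p := 2*ν+1) (Or.inl ht.ne')
    have := hp.mul ((d0.mul e1).sub (d1.mul e0))
    refine this.congr_deriv ?_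
    rw [Real.rpow_sub_one ht.ne']
    simp only [Pi.sub_apply, Pi.mul_apply]
    field_simp
    ring
  have hWc : ∀ t, 0 < t → W t = W z := by
    intro t ht
    exact isOpen_Ioi.is_const_of_deriv_eq_zero (convex_Ioi (0:ℝ)).isPreconnected
      (fun s hs => (hWd s hs).differentiableAt.differentiableWithinAt)
      (fun s hs => (hWd s hs).deriv) ht hz
  -- the constant is zero
  have hc : W z = 0 := by
    set c := W z with hcdef
    set B : ℝ := (2 * jM ν 0)^2 with hB
    have hm0 := jM_zero_pos ν hν.le
    have hBpos : 0 < B := by positivity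
    have hev1 : ∀ᶠ t in nhdsWithin (0:ℝ) (Ioi 0), 0 < jM ν t :=
      (((jM_cont ν hν.le).tendsto 0).eventually (lt_mem_nhds hm0)).filter_mono nhdsWithin_le_nhds
    have hev2 : ∀ᶠ t in nhdsWithin (0:ℝ) (Ioi 0), jM ν t < 2 * jM ν 0 :=
      (((jM_cont ν hν.le).tendsto 0).eventually (gt_mem_nhds (by linarith))).filter_mono nhdsWithin_le_nhds
    obtain ⟨d, hd, hd2⟩ := mem_nhdsGT_iff_exists_Ioo_subset.1 (hev1.and hev2)
    have hd : 0 < d := hd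
    have hQ : ∀ t ∈ Ioo 0 d, HasDerivAt (fun t => c * (N t / jM ν t) + c^2/B * (t^(-(2*ν)) / (2*ν)))
        (c^2 * t^(-(2*ν+1)) * (1/(jM ν t)^2 - 1/B)) t := by
      intro t ht
      obtain ⟨hp1, hp2⟩ := hd2 ht
      have hp1 : 0 < jM ν t := hp1
      have ht0 : 0 < t := ht.1
      obtain ⟨d0, d1⟩ := jM_sol ν hν.le t ht0
      obtain ⟨e0, e1⟩ := hN t ht0
      have hp := Real.hasDerivAt_rpow_const (p := -(2*ν)) (Or.inl ht0.ne')
      have := ((e0.div d0 hp1.ne').const_mul c).add ((hp.div_const (2*ν)).const_mul (c^2/B))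
      refine this.congr_deriv ?_
      have hw := hWc t ht0
      simp only [hW] at hw
      have e3 : N1 t * jM ν t - N t * jM1 ν t = c * t^(-(2*ν+1)) := by
        rw [← hw, mul_comm (t ^ (2*ν+1)), mul_assoc, ← Real.rpow_add ht0]
        simp; ring
      rw [e3]
      have e4 : -(2*ν) - 1 = -(2*ν+1) := by ring
      rw [e4]
      field_simp
      ring
    have hmono : MonotoneOn (fun t => c * (N t / jM ν t) + c^2/B * (t^(-(2*ν)) / (2*ν))) (Ioo 0 d) := by
      apply monotoneOn_of_deriv_nonneg (convex_Ioo 0 d)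
      · exact fun t ht => (hQ t ht).continuousAt.continuousWithinAt
      · intro t ht
        rw [interior_Ioo] at ht
        exact (hQ t ht).differentiableAt.differentiableWithinAt
      · intro t ht
        rw [interior_Ioo] at ht
        rw [(hQ t ht).deriv]
        obtain ⟨hp1, hp2⟩ := hd2 ht
        have hp1 : 0 < jM ν t := hp1
        have hp2 : jM ν t < 2 * jM ν 0 := hp2
        have ht0 : 0 < t := ht.1
        have : 1/B ≤ 1/(jM ν t)^2 := by
          apply one_div_le_one_div_of_le (by positivity)
          rw [hB]; gcongr
        have : 0 ≤ 1/(jM ν t)^2 - 1/B := by linarith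
        positivity
    have hd2m : d/2 ∈ Ioo 0 d := ⟨by linarith, by linarith⟩
    set Q0 := c * (N (d/2) / jM ν (d/2)) + c^2/B * ((d/2)^(-(2*ν)) / (2*ν)) with hQ0
    have hin : ∀ᶠ t in nhdsWithin (0:ℝ) (Ioi 0),
        c * ((t^(2*ν) * N t) / jM ν t) + c^2/B/(2*ν) ≤ t^(2*ν) * Q0 := by
      have hevd : ∀ᶠ t in nhdsWithin (0:ℝ) (Ioi 0), t < d/2 :=
        (eventually_lt_nhds (by linarith)).filter_mono nhdsWithin_le_nhds
      filter_upwards [hevd, self_mem_nhdsWithin] with t h1 h2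
      have h2 : 0 < t := h2
      have := hmono (a := t) ⟨h2, by linarith⟩ hd2m h1.le
      have h3 : 0 < t^(2*ν) := Real.rpow_pos_of_pos h2 _
      have h4 := mul_le_mul_of_nonneg_left this h3.le
      refine le_trans (le_of_eq ?_) h4
      simp only
      rw [Real.rpow_neg h2.le]
      field_simp
    have hl1 : Tendsto (fun t : ℝ => c * ((t^(2*ν) * N t) / jM ν t) + c^2/B/(2*ν))
        (nhdsWithin (0:ℝ) (Ioi 0)) (nhds (c * (0 / jM ν 0) + c^2/B/(2*ν))) := by
      refine Tendsto.add_const _ (Tendsto.const_mul _ (hlim.div ?_ hm0.ne'))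
      exact ((jM_cont ν hν.le).tendsto 0).mono_left nhdsWithin_le_nhds
    have hl2 : Tendsto (fun t : ℝ => t^(2*ν) * Q0)
        (nhdsWithin (0:ℝ) (Ioi 0)) (nhds ((0:ℝ)^(2*ν) * Q0)) := by
      refine Tendsto.mul_const _ ?_
      exact ((Real.continuous_rpow_const (by positivity)).tendsto 0).mono_left nhdsWithin_le_nhds
    have := le_of_tendsto_of_tendsto hl1 hl2 hin
    rw [Real.zero_rpow (by positivity)] at this
    simp only [zero_div, mul_zero, zero_add, zero_mul] at this
    by_contra hcne
    have : 0 < c^2/B/(2*ν) := by positivity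
    linarith
  simp only [hW, h0] at hc
  have h1 := msol_simple ν hν.le z hz h0
  have h2 : z^(2*ν+1) ≠ 0 := (Real.rpow_pos_of_pos hz _).ne'
  simpa [h1, h2] using hc

-- SECTION B
section laplace

noncomputable def lP (a w : ℝ) : ℂ := ((w:ℂ) + Complex.I * (w:ℂ)^2)^(a:ℂ)

noncomputable def lE (a : ℝ) (j : ℕ) (t w : ℝ) : ℂ :=
  (w:ℂ)^j * Complex.exp (-(2*t*w : ℝ)) * lP a w

noncomputable def lK (a : ℝ) (j : ℕ) (t : ℝ) : ℂ := ∫ w in Ioi (0:ℝ), lE a j t w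

lemma base_slit (w c d : ℝ) (hw : 0 < c * w) :
    (c * w : ℂ) + Complex.I * ((d : ℂ) * (w:ℂ)^2) ∈ Complex.slitPlane := by
  left
  have : ((c * w : ℂ) + Complex.I * ((d : ℂ) * (w:ℂ)^2)).re = c * w := by
    simp [pow_two]
  rw [this]; exact hw

lemma lP_continuousOn (a c d : ℝ) (hc : 0 < c) :
    ContinuousOn (fun w : ℝ => ((c * w : ℂ) + Complex.I * ((d : ℂ) * (w:ℂ)^2))^(a:ℂ)) (Ioi 0) := by
  apply ContinuousOn.cpow
  · fun_prop
  · fun_prop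
  · intro w hw
    exact base_slit w c d (mul_pos hc hw)

lemma lP_norm_le (a : ℝ) (ha : 0 ≤ a) (c d w : ℝ) (hc : 0 ≤ c) (hc1 : c ≤ 1) (hd : 0 ≤ d)
    (hd1 : d ≤ 1) (hw : 0 ≤ w) :
    ‖((c * w : ℂ) + Complex.I * ((d : ℂ) * (w:ℂ)^2))^(a:ℂ)‖ ≤ (1 + w)^(⌈2*a⌉₊) := by
  rw [Complex.norm_cpow_real]
  have h1 : ‖(c * w : ℂ) + Complex.I * ((d : ℂ) * (w:ℂ)^2)‖ ≤ (1+w)^2 := by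
    refine (norm_add_le _ _).trans ?_
    simp only [norm_mul, norm_pow, Complex.norm_real, Complex.norm_I, Real.norm_eq_abs,
      abs_of_nonneg hc, abs_of_nonneg hd, abs_of_nonneg hw]
    nlinarith [mul_le_mul_of_nonneg_right hc1 hw, mul_le_mul_of_nonneg_right hd1 (sq_nonneg w)]
  calc _ ≤ ((1+w)^2)^a := Real.rpow_le_rpow (norm_nonneg _) h1 ha
    _ = (1+w)^(2*a) := by
        rw [show (2*a) = ((2:ℕ):ℝ)*a by norm_num, Real.rpow_mul (by positivity), Real.rpow_natCast]
    _ ≤ (1+w)^((⌈2*a⌉₊ : ℕ) : ℝ) :=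
        Real.rpow_le_rpow_of_exponent_le (by linarith) (Nat.le_ceil _)
    _ = _ := Real.rpow_natCast _ _

lemma poly_exp_integrable (n : ℕ) (c : ℝ) (hc : 0 < c) :
    MeasureTheory.IntegrableOn (fun w : ℝ => (1+w)^n * Real.exp (-(c*w))) (Ioi 0) := by
  have h1 : MeasureTheory.IntegrableOn
      (fun w : ℝ => ((n.factorial : ℝ) / (c/2)^n * Real.exp (c/2)) * Real.exp (-(c/2) * w)) (Ioi 0) :=
    (integrableOn_exp_mul_Ioi (by linarith) 0).const_mul _
  refine MeasureTheory.Integrable.mono' h1 ?_ ?_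
  · exact (by fun_prop : Continuous (fun w : ℝ => (1+w)^n * Real.exp (-(c*w)))).aestronglyMeasurable
  · refine (MeasureTheory.ae_restrict_iff' measurableSet_Ioi).2 (Eventually.of_forall ?_)
    intro w hw
    have hw : 0 < w := hw
    rw [Real.norm_eq_abs, abs_of_nonneg (by positivity)]
    have h2 := Real.pow_div_factorial_le_exp (c/2*(1+w)) (by positivity) n
    rw [div_le_iff₀ (by positivity), mul_pow] at h2
    have h3 : (1+w)^n ≤ Real.exp (c/2*(1+w)) * n.factorial / (c/2)^n := by
      rw [le_div_iff₀ (by positivity)]; linarith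
    calc (1+w)^n * Real.exp (-(c*w)) ≤ (Real.exp (c/2*(1+w)) * n.factorial / (c/2)^n) * Real.exp (-(c*w)) := by
          gcongr
      _ = (n.factorial : ℝ) / (c/2)^n * (Real.exp (c/2*(1+w)) * Real.exp (-(c*w))) := by ring
      _ = (n.factorial : ℝ) / (c/2)^n * (Real.exp (c/2) * Real.exp (-(c/2)*w)) := by
          rw [← Real.exp_add, ← Real.exp_add]; congr 2; ring
      _ = _ := by ring

lemma lP_eq (a w : ℝ) : lP a w = (((1:ℝ) * w : ℂ) + Complex.I * (((1:ℝ) : ℂ) * (w:ℂ)^2))^(a:ℂ) := by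
  simp [lP]

lemma lE_continuousOn (a : ℝ) (j : ℕ) (t : ℝ) : ContinuousOn (lE a j t) (Ioi 0) := by
  unfold lE
  have h := lP_continuousOn a 1 1 one_pos
  have h2 : ContinuousOn (lP a) (Ioi 0) := h.congr fun w _ => lP_eq a w
  refine ContinuousOn.mul ?_ h2
  fun_prop

lemma lE_norm_le (a : ℝ) (ha : 0 ≤ a) (j : ℕ) (t s w : ℝ) (hts : s ≤ t) (hw : 0 < w) :
    ‖lE a j t w‖ ≤ (1+w)^(j + ⌈2*a⌉₊) * Real.exp (-(2*s*w)) := by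
  unfold lE
  rw [norm_mul, norm_mul, lP_eq, norm_pow, Complex.norm_real, Real.norm_eq_abs, abs_of_pos hw,
    Complex.norm_exp]
  have h1 := lP_norm_le a ha 1 1 w (by norm_num) le_rfl (by norm_num) le_rfl hw.le
  have h2 : w^j ≤ (1+w)^j := by gcongr; linarith
  have h3 : Real.exp ((-((2*t*w : ℝ) : ℂ)).re) ≤ Real.exp (-(2*s*w)) := by
    apply Real.exp_le_exp.2
    rw [Complex.neg_re, Complex.ofReal_re]
    have := mul_le_mul_of_nonneg_right hts hw.le
    linarith
  calc _ ≤ (1+w)^j * Real.exp (-(2*s*w)) * (1 + w)^(⌈2*a⌉₊) := by gcongr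
    _ = _ := by rw [pow_add]; ring

lemma lE_integrable (a : ℝ) (ha : 0 ≤ a) (j : ℕ) (t : ℝ) (ht : 0 < t) :
    MeasureTheory.IntegrableOn (lE a j t) (Ioi 0) := by
  refine MeasureTheory.Integrable.mono' (poly_exp_integrable (j + ⌈2*a⌉₊) (2*t) (by positivity))
    ((lE_continuousOn a j t).aestronglyMeasurable measurableSet_Ioi) ?_
  refine (MeasureTheory.ae_restrict_iff' measurableSet_Ioi).2 (Eventually.of_forall ?_)
  intro w hw
  exact lE_norm_le a ha j t t w le_rfl hw

lemma lK_hasDerivAt (a : ℝ) (ha : 0 ≤ a) (j : ℕ) (t : ℝ) (ht : 0 < t) :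
    HasDerivAt (lK a j) (-2 * lK a (j+1) t) t := by
  have key := hasDerivAt_integral_of_dominated_loc_of_deriv_le
    (μ := MeasureTheory.volume.restrict (Ioi (0:ℝ)))
    (F := fun t w => lE a j t w) (F' := fun t w => -2 * lE a (j+1) t w) (x₀ := t) (s := Ioi (t/2))
    (bound := fun w => 2 * ((1+w)^(j + 1 + ⌈2*a⌉₊) * Real.exp (-(2*(t/2)*w))))
    (Ioi_mem_nhds (by linarith))
    (Eventually.of_forall fun s => (lE_continuousOn a j s).aestronglyMeasurable measurableSet_Ioi)
    (lE_integrable a ha j t ht)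
    (((lE_continuousOn a (j+1) t).aestronglyMeasurable measurableSet_Ioi).const_mul _)
    ?_ ((poly_exp_integrable (j + 1 + ⌈2*a⌉₊) (2*(t/2)) (by positivity)).const_mul 2) ?_
  · have := key.2
    rw [MeasureTheory.integral_const_mul] at this
    exact this
  · refine (MeasureTheory.ae_restrict_iff' measurableSet_Ioi).2 (Eventually.of_forall ?_)
    intro w hw s hs
    rw [norm_mul]
    have := lE_norm_le a ha (j+1) s (t/2) w (le_of_lt hs) hw
    have h2 : ‖(-2:ℂ)‖ = 2 := by simp
    rw [h2]
    linarith
  · refine Eventually.of_forall ?_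
    intro w s _
    unfold lE
    have h1 : HasDerivAt (fun s : ℝ => ((-(2*s*w : ℝ) : ℝ) : ℂ)) (-(2*w : ℝ) : ℝ) s := by
      apply HasDerivAt.ofReal_comp
      have := (((hasDerivAt_id s).const_mul 2).mul_const w).neg
      exact this.congr_deriv (by simp)
    have h2 := ((h1.cexp.const_mul ((w:ℂ)^j)).mul_const (lP a w))
    simp only [Complex.ofReal_neg] at h2
    refine h2.congr_deriv ?_
    push_cast
    ring

lemma lK_ident (a : ℝ) (ha : 0 < a) (t : ℝ) (ht : 0 < t) :
    -2*t*lK a 1 t - 2*Complex.I*t*lK a 2 t + (a+1) * lK a 0 t + 2*Complex.I*(a+1)*lK a 1 t = 0 := by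
  have i0 := lE_integrable a ha.le 0 t ht
  have i1 := lE_integrable a ha.le 1 t ht
  have i2 := lE_integrable a ha.le 2 t ht
  have hint : MeasureTheory.IntegrableOn (fun w => -2*t*lE a 1 t w - 2*Complex.I*t*lE a 2 t w
      + (a+1) * lE a 0 t w + 2*Complex.I*(a+1)*lE a 1 t w) (Ioi 0) :=
    (((i1.const_mul _).sub (i2.const_mul _)).add (i0.const_mul _)).add (i1.const_mul _)
  have e : ∫ w in Ioi (0:ℝ), (-2*t*lE a 1 t w - 2*Complex.I*t*lE a 2 t w
      + (a+1) * lE a 0 t w + 2*Complex.I*(a+1)*lE a 1 t w) =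
      -2*t*lK a 1 t - 2*Complex.I*t*lK a 2 t + (a+1) * lK a 0 t + 2*Complex.I*(a+1)*lK a 1 t := by
    have A1 := i1.const_mul (-2*(t:ℂ))
    have A2 := i2.const_mul (2*Complex.I*(t:ℂ))
    have A3 := i0.const_mul ((a:ℂ)+1)
    have A4 := i1.const_mul (2*Complex.I*((a:ℂ)+1))
    have q1 := MeasureTheory.integral_add ((A1.sub A2).add A3) A4
    have q2 := MeasureTheory.integral_add (A1.sub A2) A3
    have q3 := MeasureTheory.integral_sub A1 A2
    simp only [Pi.add_apply, Pi.sub_apply] at q1 q2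
    rw [q1, q2, q3]
    simp only [MeasureTheory.integral_const_mul]
    rfl
  rw [← e]
  -- primitive
  set G : ℝ → ℂ := fun w => Complex.exp (-(2*t*w : ℝ)) * (((w:ℂ) + Complex.I * (w:ℂ)^2) * lP a w) with hG
  have hG' : ∀ w, G w = lE a 1 t w + Complex.I * lE a 2 t w := by
    intro w; simp only [hG, lE]; ring
  have hcont0 : ContinuousWithinAt G (Ici 0) 0 := by
    apply ContinuousAt.continuousWithinAt
    have hb : ContinuousAt (lP a) 0 := by
      have : Tendsto (lP a) (nhds 0) (nhds 0) := by
        rw [tendsto_zero_iff_norm_tendsto_zero]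
        have h1 : ∀ w, ‖lP a w‖ = ‖(w:ℂ) + Complex.I * (w:ℂ)^2‖^a := fun w => by
          unfold lP; rw [Complex.norm_cpow_real]
        simp_rw [h1]
        have : Continuous (fun w : ℝ => ‖(w:ℂ) + Complex.I * (w:ℂ)^2‖^a) :=
          (by fun_prop : Continuous (fun w : ℝ => ‖(w:ℂ) + Complex.I * (w:ℂ)^2‖)).rpow_const
            (fun _ => Or.inr ha.le)
        have h2 := this.tendsto 0
        simpa [Real.zero_rpow ha.ne'] using h2
      unfold ContinuousAt
      have h0 : lP a 0 = 0 := by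
        unfold lP
        simp [Complex.zero_cpow, ha.ne']
      rw [h0]; exact this
    have hc : ContinuousAt (fun w : ℝ => Complex.exp (-(2*t*w : ℝ))) 0 := by fun_prop
    have hd : ContinuousAt (fun w : ℝ => ((w:ℂ) + Complex.I * (w:ℂ)^2)) 0 := by fun_prop
    exact hc.mul (hd.mul hb)
  have hderiv : ∀ w ∈ Ioi (0:ℝ), HasDerivAt G (-2*t*lE a 1 t w - 2*Complex.I*t*lE a 2 t w
      + (a+1) * lE a 0 t w + 2*Complex.I*(a+1)*lE a 1 t w) w := by
    intro w hw
    have hs : (w:ℂ) + Complex.I * (w:ℂ)^2 ∈ Complex.slitPlane := by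
      have := base_slit w 1 1 (by simpa using hw)
      simpa using this
    have hne := Complex.slitPlane_ne_zero hs
    have h1 : HasDerivAt (fun w : ℝ => ((-(2*t*w : ℝ) : ℝ) : ℂ)) (-(2*t : ℝ) : ℝ) w := by
      apply HasDerivAt.ofReal_comp
      have := ((hasDerivAt_id w).const_mul (2*t)).neg
      exact this.congr_deriv (by simp)
    have h2 : HasDerivAt (fun w : ℂ => (w + Complex.I * w^2)) (1 + Complex.I * (2 * w)) (w:ℂ) := by
      have := (hasDerivAt_id (w:ℂ)).add (((hasDerivAt_id (w:ℂ)).pow 2).const_mul Complex.I)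
      refine this.congr_deriv ?_
      simp
    have h3 := (h2.cpow_const (c := (a:ℂ)) hs)
    have h5 := h1.cexp.mul ((h2.mul h3).comp_ofReal)
    simp only [Complex.ofReal_neg] at h5
    refine h5.congr_deriv ?_
    simp only [lE, lP, Pi.mul_apply]
    rw [Complex.cpow_sub _ _ hne, Complex.cpow_one]
    push_cast
    have e9 : ∀ b X c d : ℂ, b ≠ 0 → b * (d * (X / b) * c) = d * X * c := by
      intro b X c d hb
      field_simp
    rw [e9 _ _ _ _ hne]
    ring
  have hlim : Tendsto G atTop (nhds 0) := by
    have hb : ∀ w > 0, ‖G w‖ ≤ 2 * ((1+w)^(2 + ⌈2*a⌉₊) * Real.exp (-(2*t*w))) := by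
      intro w hw
      rw [hG']
      have n1 := lE_norm_le a ha.le 1 t t w le_rfl hw
      have n2 := lE_norm_le a ha.le 2 t t w le_rfl hw
      have n3 : (1+w)^(1+⌈2*a⌉₊) ≤ (1+w)^(2+⌈2*a⌉₊) := pow_le_pow_right₀ (by linarith) (by omega)
      have n4 := mul_le_mul_of_nonneg_right n3 (Real.exp_pos (-(2*t*w))).le
      have := norm_add_le (lE a 1 t w) (Complex.I * lE a 2 t w)
      rw [norm_mul, Complex.norm_I, one_mul] at this
      linarith
    have hz : Tendsto (fun w : ℝ => 2 * ((1+w)^(2 + ⌈2*a⌉₊) * Real.exp (-(2*t*w)))) atTop (nhds 0) := by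
      have hh := Real.tendsto_pow_mul_exp_neg_atTop_nhds_zero (2 + ⌈2*a⌉₊)
      have hu : Tendsto (fun w : ℝ => 2*t*(1+w)) atTop atTop :=
        (tendsto_atTop_add_const_left _ 1 tendsto_id).const_mul_atTop (by positivity)
      have := (hh.comp hu).const_mul (2 * Real.exp (2*t) / (2*t)^(2 + ⌈2*a⌉₊))
      rw [mul_zero] at this
      refine this.congr ?_
      intro w
      simp only [Function.comp]
      rw [mul_pow (2*t) (1+w), show -(2*t*(1+w)) = -(2*t*w) + -(2*t) by ring, Real.exp_add, Real.exp_neg (2*t)]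
      have := (Real.exp_pos (2*t)).ne'
      have h2 : (2*t)^(2 + ⌈2*a⌉₊) ≠ 0 := by positivity
      field_simp
      try ring
    refine squeeze_zero_norm' ?_ hz
    filter_upwards [eventually_gt_atTop 0] with w hw using hb w hw
  have := MeasureTheory.integral_Ioi_of_hasDerivAt_of_tendsto hcont0 hderiv hint hlim
  rw [this]
  simp [hG]

lemma pos_mul_cpow (r : ℝ) (hr : 0 < r) (z c : ℂ) : ((r:ℂ) * z)^c = (r:ℂ)^c * z^c := by
  by_cases hz : z = 0
  · by_cases hc : c = 0
    · simp [hc]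
    · simp [hz, hc, Complex.zero_cpow]
  · have hr' : (r:ℂ) ≠ 0 := by exact_mod_cast hr.ne'
    rw [Complex.cpow_def_of_ne_zero (mul_ne_zero hr' hz), Complex.cpow_def_of_ne_zero hr',
      Complex.cpow_def_of_ne_zero hz, Complex.log_ofReal_mul hr hz, ← Complex.exp_add,
      Complex.ofReal_log hr.le]
    ring_nf

/-- scaling -/
lemma lK_scale (a : ℝ) (t r : ℝ) (ht : 0 < t) (hr : 0 < r) :
    ((r^a * t : ℝ) : ℂ) * lK a 0 t = ∫ s in Ioi (0:ℝ), Complex.exp (-(2*s : ℝ)) *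
      ((((r/t : ℝ) : ℂ) * s + Complex.I * (((r/t^2 : ℝ) : ℂ) * (s:ℂ)^2))^(a:ℂ)) := by
  have h := MeasureTheory.integral_comp_mul_left_Ioi (fun w => lE a 0 t w) 0 (inv_pos.2 ht)
  rw [mul_zero, inv_inv] at h
  have h2 : lK a 0 t = (t:ℂ)⁻¹ * ∫ s in Ioi (0:ℝ), lE a 0 t (t⁻¹ * s) := by
    rw [h]
    have : (t:ℂ) ≠ 0 := by exact_mod_cast ht.ne'
    rw [Complex.real_smul, inv_mul_cancel_left₀ this]
    rfl
  rw [h2, ← mul_assoc, ← MeasureTheory.integral_const_mul]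
  apply MeasureTheory.setIntegral_congr_fun measurableSet_Ioi
  intro s hs
  have htc : (t:ℂ) ≠ 0 := by exact_mod_cast ht.ne'
  simp only [lE, lP, pow_zero, one_mul]
  have e1 : (2 * t * (t⁻¹ * s)) = 2 * s := by field_simp
  rw [e1]
  have e2 : ((((r/t : ℝ) : ℂ) * s + Complex.I * (((r/t^2 : ℝ) : ℂ) * (s:ℂ)^2))^(a:ℂ))
      = ((r^a : ℝ) : ℂ) * ((((t⁻¹ * s : ℝ) : ℂ) + Complex.I * ((t⁻¹ * s : ℝ) : ℂ)^2)^(a:ℂ)) := by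
    rw [Complex.ofReal_cpow hr.le, ← pos_mul_cpow r hr]
    congr 1
    push_cast
    field_simp
  rw [e2]
  push_cast
  field_simp


lemma lK_dom (a : ℝ) (ha : 0 ≤ a) (c d : ℝ) (hc : 0 < c) (hc1 : c ≤ 1) (hd : 0 ≤ d) (hd1 : d ≤ 1)
    (s : ℝ) (hs : 0 < s) :
    ‖Complex.exp (-(2*s : ℝ)) * (((c : ℂ) * s + Complex.I * ((d : ℂ) * (s:ℂ)^2))^(a:ℂ))‖
      ≤ (1+s)^(⌈2*a⌉₊) * Real.exp (-(2*s)) := by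
  rw [norm_mul, Complex.norm_exp, Complex.neg_re, Complex.ofReal_re, mul_comm]
  have := lP_norm_le a ha c d s hc.le hc1 hd hd1 hs.le
  gcongr

lemma lK_meas (a : ℝ) (c d : ℝ) (hc : 0 < c) :
    MeasureTheory.AEStronglyMeasurable (fun s : ℝ => Complex.exp (-(2*s : ℝ)) *
      (((c : ℂ) * s + Complex.I * ((d : ℂ) * (s:ℂ)^2))^(a:ℂ)))
      (MeasureTheory.volume.restrict (Ioi 0)) := by
  refine ContinuousOn.aestronglyMeasurable ?_ measurableSet_Ioi
  refine ContinuousOn.mul (by fun_prop) (lP_continuousOn a c d hc)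

lemma lK_zero (a : ℝ) (ha : 0 < a) :
    Tendsto (fun t : ℝ => ((t^(2*a+1) : ℝ) : ℂ) * lK a 0 t) (nhdsWithin 0 (Ioi 0))
      (nhds (∫ s in Ioi (0:ℝ), Complex.exp (-(2*s : ℝ)) * ((Complex.I * (s:ℂ)^2)^(a:ℂ)))) := by
  have h1 : Tendsto (fun t : ℝ => ∫ s in Ioi (0:ℝ), Complex.exp (-(2*s : ℝ)) *
      (((t : ℂ) * s + Complex.I * (((1:ℝ) : ℂ) * (s:ℂ)^2))^(a:ℂ))) (nhdsWithin 0 (Ioi 0))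
      (nhds (∫ s in Ioi (0:ℝ), Complex.exp (-(2*s : ℝ)) * ((Complex.I * (s:ℂ)^2)^(a:ℂ)))) := by
    apply MeasureTheory.tendsto_integral_filter_of_dominated_convergence
      (fun s => (1+s)^(⌈2*a⌉₊) * Real.exp (-(2*s)))
    · filter_upwards [self_mem_nhdsWithin] with t ht using lK_meas a t 1 ht
    · have h1 : ∀ᶠ t in nhdsWithin (0:ℝ) (Ioi 0), t < 1 :=
        (eventually_lt_nhds one_pos).filter_mono nhdsWithin_le_nhds
      filter_upwards [self_mem_nhdsWithin, h1] with t ht ht1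
      refine (MeasureTheory.ae_restrict_iff' measurableSet_Ioi).2 (Eventually.of_forall ?_)
      intro s hs
      exact lK_dom a ha.le t 1 ht ht1.le zero_le_one le_rfl s hs
    · exact poly_exp_integrable _ 2 two_pos
    · refine (MeasureTheory.ae_restrict_iff' measurableSet_Ioi).2 (Eventually.of_forall ?_)
      intro s hs
      have hs : 0 < s := hs
      have hsl : ((0:ℝ) : ℂ) * s + Complex.I * (((1:ℝ) : ℂ) * (s:ℂ)^2) ∈ Complex.slitPlane := by
        right
        simp [pow_two, hs.ne']
      have : ContinuousAt (fun t : ℝ => Complex.exp (-(2*s : ℝ)) *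
         (((t : ℂ) * s + Complex.I * (((1:ℝ) : ℂ) * (s:ℂ)^2))^(a:ℂ))) 0 := by
        refine ContinuousAt.mul continuousAt_const ?_
        exact ContinuousAt.cpow (by fun_prop) continuousAt_const hsl
      have h2 := this.tendsto.mono_left (nhdsWithin_le_nhds (s := Ioi (0:ℝ)))
      simpa using h2
  refine h1.congr' ?_
  filter_upwards [self_mem_nhdsWithin] with t ht
  have ht : 0 < t := ht
  have h3 := lK_scale a t (t^2) ht (by positivity)
  have e1 : t^2/t = t := by field_simp
  have e2 : t^2/t^2 = 1 := by field_simp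
  rw [e1, e2] at h3
  rw [← h3]
  congr 2
  rw [Real.rpow_add ht, Real.rpow_one, show (2*a) = ((2:ℕ):ℝ)*a by norm_num, Real.rpow_mul ht.le,
    Real.rpow_natCast]

lemma lK_infty (a : ℝ) (ha : 0 < a) :
    ∃ C : ℝ, 0 < C ∧ Tendsto (fun t : ℝ => ((t^(a+1) : ℝ) : ℂ) * lK a 0 t) atTop (nhds (C:ℂ)) := by
  have hCpos : 0 < ∫ s in Ioi (0:ℝ), s^a * Real.exp (-(2*s)) := by
    have h := Real.integral_rpow_mul_exp_neg_mul_Ioi (a := a+1) (r := 2) (by linarith) two_pos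
    rw [add_sub_cancel_right] at h
    rw [h]
    have := Real.Gamma_pos_of_pos (s := a+1) (by linarith)
    positivity
  refine ⟨_, hCpos, ?_⟩
  have h1 : Tendsto (fun t : ℝ => ∫ s in Ioi (0:ℝ), Complex.exp (-(2*s : ℝ)) *
      ((((1:ℝ) : ℂ) * s + Complex.I * (((1/t : ℝ) : ℂ) * (s:ℂ)^2))^(a:ℂ))) atTop
      (nhds (∫ s in Ioi (0:ℝ), ((s^a * Real.exp (-(2*s)) : ℝ) : ℂ))) := by
    apply MeasureTheory.tendsto_integral_filter_of_dominated_convergence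
      (fun s => (1+s)^(⌈2*a⌉₊) * Real.exp (-(2*s)))
    · exact Eventually.of_forall fun t => lK_meas a 1 (1/t) one_pos
    · filter_upwards [eventually_ge_atTop 1] with t ht
      refine (MeasureTheory.ae_restrict_iff' measurableSet_Ioi).2 (Eventually.of_forall ?_)
      intro s hs
      refine lK_dom a ha.le 1 (1/t) one_pos le_rfl (by positivity) ?_ s hs
      rw [div_le_one (by linarith)]; exact ht
    · exact poly_exp_integrable _ 2 two_pos
    · refine (MeasureTheory.ae_restrict_iff' measurableSet_Ioi).2 (Eventually.of_forall ?_)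
      intro s hs
      have hs : 0 < s := hs
      have hsl : (((1:ℝ) : ℂ) * s + Complex.I * (((0:ℝ) : ℂ) * (s:ℂ)^2)) ∈ Complex.slitPlane := by
        exact base_slit s 1 0 (by simpa using hs)
      have : ContinuousAt (fun d : ℝ => Complex.exp (-(2*s : ℝ)) *
         ((((1:ℝ) : ℂ) * s + Complex.I * ((d : ℂ) * (s:ℂ)^2))^(a:ℂ))) 0 := by
        refine ContinuousAt.mul continuousAt_const ?_
        exact ContinuousAt.cpow (by fun_prop) continuousAt_const hsl
      have h2 := this.tendsto.comp (tendsto_const_nhds.div_atTop tendsto_id : Tendsto (fun t : ℝ => 1/t) atTop (nhds 0))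
      refine (h2.congr fun t => rfl).trans (le_of_eq ?_)
      congr 1
      push_cast
      rw [Complex.ofReal_cpow hs.le]
      simp [mul_comm]
  rw [integral_complex_ofReal] at h1
  refine h1.congr' ?_
  filter_upwards [eventually_gt_atTop 0] with t ht
  have h3 := lK_scale a t t ht ht
  have e1 : t/t = 1 := by field_simp
  have e2 : t/t^2 = 1/t := by field_simp
  rw [e1, e2] at h3
  rw [← h3]
  congr 2
  rw [Real.rpow_add ht, Real.rpow_one]

lemma second_solution (ν : ℝ) (hν : 1/2 < ν) : ∃ (N N1 : ℝ → ℝ) (C : ℝ), IsMSol ν N N1 ∧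
    Tendsto (fun t : ℝ => t^(2*ν) * N t) (nhdsWithin 0 (Ioi 0)) (nhds 0) ∧ 0 < C ∧
    Tendsto (fun t : ℝ => t^(ν+1/2) * N t - C * Real.sin (t - π*ν/2 + π/4)) atTop (nhds 0) := by
  set a : ℝ := ν - 1/2 with ha'
  have ha : 0 < a := by rw [ha']; linarith
  obtain ⟨C, hC, hinf⟩ := lK_infty a ha
  set ω : ℂ := Complex.exp (-((π*a/2 : ℝ) : ℂ) * Complex.I) with hω
  have hωn : ‖ω‖ = 1 := by
    rw [hω, ← Complex.ofReal_neg]; exact Complex.norm_exp_ofReal_mul_I _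
  set E : ℝ → ℂ := fun t => ω * Complex.exp ((t:ℂ) * Complex.I) with hE
  have hEd : ∀ t : ℝ, HasDerivAt E (Complex.I * E t) t := by
    intro t
    have h1 : HasDerivAt (fun t : ℂ => t * Complex.I) Complex.I (t:ℂ) := by
      simpa using (hasDerivAt_id (t:ℂ)).mul_const Complex.I
    have := (h1.cexp.const_mul ω).comp_ofReal
    refine this.congr_deriv ?_
    simp only [hE]; ring
  have him : ∀ (f : ℝ → ℂ) (f' : ℂ) (t : ℝ), HasDerivAt f f' t →
      HasDerivAt (fun t => (f t).im) f'.im t := by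
    intro f f' t h
    exact (Complex.imCLM.hasFDerivAt.comp_hasDerivAt t h)
  refine ⟨fun t => (E t * lK a 0 t).im, fun t => (E t * (Complex.I * lK a 0 t - 2 * lK a 1 t)).im,
    C, ?_, ?_, hC, ?_⟩
  · intro t ht
    have d0 := lK_hasDerivAt a ha.le 0 t ht
    have d1 := lK_hasDerivAt a ha.le 1 t ht
    constructor
    · refine him _ _ t (((hEd t).mul d0).congr_deriv ?_)
      ring
    · have := him _ _ t ((hEd t).mul ((d0.const_mul Complex.I).sub (d1.const_mul 2)))
      refine this.congr_deriv ?_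
      have hid := lK_ident a ha t ht
      have htc : (t:ℂ) ≠ 0 := by exact_mod_cast ht.ne'
      have ea : (a:ℂ) + 1 = (2*ν+1)/2 := by rw [ha']; push_cast; ring
      rw [ea] at hid
      have e4 : 4 * lK a 2 t = 4 * Complex.I * lK a 1 t
          - (2*ν+1)/t * (Complex.I * lK a 0 t - 2 * lK a 1 t) := by
        field_simp
        linear_combination (2 * Complex.I) * hid + (4 * t * lK a 2 t - 2 * (2*ν+1) * lK a 1 t) * Complex.I_mul_I
      have e5 : ∀ z : ℂ, (2*ν+1)/t * z.im = (((2*ν+1)/t : ℝ) * z).im := by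
        intro z; rw [Complex.im_ofReal_mul]
      rw [e5, ← Complex.neg_im, ← Complex.sub_im]
      congr 1
      simp only [Pi.sub_apply]
      push_cast
      linear_combination (E t) * e4 + (E t * lK a 0 t) * Complex.I_mul_I
  · have h0 := lK_zero a ha
    have hEc : Tendsto E (nhdsWithin 0 (Ioi 0)) (nhds ω) := by
      have := (hEd 0).continuousAt.tendsto.mono_left (nhdsWithin_le_nhds (s := Ioi (0:ℝ)))
      simpa [hE] using this
    have h1 := hEc.mul h0
    have h2 := (Complex.continuous_im.tendsto _).comp h1
    have e : (ω * ∫ s in Ioi (0:ℝ), Complex.exp (-(2*s : ℝ)) * ((Complex.I * (s:ℂ)^2)^(a:ℂ))).im = 0 := by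
      rw [← MeasureTheory.integral_const_mul]
      have : ∀ s ∈ Ioi (0:ℝ), ω * (Complex.exp (-(2*s : ℝ)) * ((Complex.I * (s:ℂ)^2)^(a:ℂ)))
          = ((Real.exp (-(2*s)) * (s^2)^a : ℝ) : ℂ) := by
        intro s hs
        have hs : 0 < s := hs
        have e1 : Complex.I * (s:ℂ)^2 = ((s^2 : ℝ) : ℂ) * Complex.I := by push_cast; ring
        rw [e1, pos_mul_cpow (s^2) (by positivity), Complex.cpow_def_of_ne_zero Complex.I_ne_zero,
          Complex.log_I]
        have e2 : ω * Complex.exp (π/2 * Complex.I * a) = 1 := by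
          rw [hω, ← Complex.exp_add, ← Complex.exp_zero]
          congr 1
          push_cast; ring
        push_cast
        rw [Complex.ofReal_cpow (by positivity)]
        push_cast
        linear_combination (Complex.exp (-(2*s)) * ((s:ℂ)^2)^(a:ℂ)) * e2
      rw [MeasureTheory.setIntegral_congr_fun measurableSet_Ioi this, integral_complex_ofReal]
      exact Complex.ofReal_im _
    rw [e] at h2
    refine h2.congr ?_
    intro t
    simp only [Function.comp]
    have e3 : 2*a+1 = 2*ν := by rw [ha']; ring
    rw [e3, mul_left_comm, Complex.im_ofReal_mul]
  · have hz : Tendsto (fun t : ℝ => ‖((t^(a+1) : ℝ) : ℂ) * lK a 0 t - C‖) atTop (nhds 0) := by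
      have := hinf.sub_const (C:ℂ)
      rw [sub_self] at this
      exact (tendsto_zero_iff_norm_tendsto_zero).1 this
    refine squeeze_zero_norm ?_ hz
    intro t
    have e1 : t^(ν+1/2) * (E t * lK a 0 t).im - C * Real.sin (t - π*ν/2 + π/4)
       = (E t * (((t^(a+1) : ℝ) : ℂ) * lK a 0 t - C)).im := by
      have e3 : a+1 = ν+1/2 := by rw [ha']; ring
      have e4 : (E t).im = Real.sin (t - π*ν/2 + π/4) := by
        simp only [hE, hω]
        rw [← Complex.exp_add]
        have : -((π*a/2 : ℝ) : ℂ) * Complex.I + t * Complex.I = ((t - π*ν/2 + π/4 : ℝ) : ℂ) * Complex.I := by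
          rw [ha']; push_cast; ring
        rw [this, Complex.exp_ofReal_mul_I_im]
      rw [mul_sub, Complex.sub_im, mul_left_comm, Complex.im_ofReal_mul, mul_comm (E t) (C:ℂ),
        Complex.im_ofReal_mul, e3, e4]
    have e2 : ‖E t‖ = 1 := by
      simp only [hE]
      rw [norm_mul, hωn, Complex.norm_exp_ofReal_mul_I, one_mul]
    rw [e1, Real.norm_eq_abs]
    refine (Complex.abs_im_le_norm _).trans ?_
    rw [norm_mul, e2, one_mul]

/-- the large zeros of `J_ν` asymptotically annihilate the sine -/
lemma zeros_sin (ν : ℝ) (hν : 1/2 < ν) (z : ℕ → ℝ) (hz : Tendsto z atTop atTop)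
    (h0 : ∀ n, 0 < z n → jM ν (z n) = 0) :
    Tendsto (fun n => Real.sin (z n - π*ν/2 + π/4)) atTop (nhds 0) := by
  obtain ⟨N, N1, C, hsol, hl, hC, hinf⟩ := second_solution ν hν
  have h1 := hinf.comp hz
  have h2 := h1.const_mul (-(1/C))
  rw [mul_zero] at h2
  refine h2.congr' ?_
  filter_upwards [hz.eventually_gt_atTop 0] with n hn
  have := msol_zero_transfer ν (by linarith) N N1 hsol hl (z n) hn (h0 n hn)
  simp only [Function.comp, this]
  field_simp
  ring

end laplace

-- SECTION C
lemma jMu_pos (ν : ℝ) (hν : 0 < ν) : ∀ t ∈ Ioc 0 ν, 0 < jM ν t * (t * jM1 ν t + ν * jM ν t) := by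
  have hd : ∀ t ∈ Ioi (0:ℝ), HasDerivAt (fun t : ℝ => t^(2*ν) * (jM ν t * (t * jM1 ν t + ν * jM ν t)))
      (t^(2*ν) / t * ((t * jM1 ν t + ν * jM ν t)^2 + (ν^2 - t^2) * (jM ν t)^2)) t := by
    intro t ht
    have ht : 0 < t := ht
    obtain ⟨d0, d1⟩ := jM_sol ν hν.le t ht
    have hp := Real.hasDerivAt_rpow_const (p := 2*ν) (Or.inl ht.ne')
    have := hp.mul (d0.mul (((hasDerivAt_id t).mul d1).add (d0.const_mul ν)))
    refine this.congr_deriv ?_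
    rw [Real.rpow_sub_one ht.ne']
    simp only [Pi.add_apply, Pi.mul_apply, id]
    field_simp
    ring
  have hmono : MonotoneOn (fun t : ℝ => t^(2*ν) * (jM ν t * (t * jM1 ν t + ν * jM ν t))) (Ioc 0 ν) := by
    apply monotoneOn_of_deriv_nonneg (convex_Ioc 0 ν)
    · exact fun t ht => (hd t ht.1).continuousAt.continuousWithinAt
    · intro t ht
      rw [interior_Ioc] at ht
      exact (hd t ht.1).differentiableAt.differentiableWithinAt
    · intro t ht
      rw [interior_Ioc] at ht
      rw [(hd t ht.1).deriv]
      have h1 : 0 < t := ht.1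
      have h2 : 0 ≤ ν^2 - t^2 := by nlinarith [ht.2, ht.1]
      positivity
  have h0 := jM_zero_pos ν hν.le
  have hc0 := jM_cont ν hν.le
  have hc1 := jM1_cont ν hν.le
  intro t ⟨h, ht⟩
  have hev : ∀ᶠ s in nhdsWithin (0:ℝ) (Ioi 0), 0 < jM ν s * (s * jM1 ν s + ν * jM ν s) := by
    have : Continuous (fun s => jM ν s * (s * jM1 ν s + ν * jM ν s)) := by fun_prop
    have h1 := (this.tendsto 0).mono_left (nhdsWithin_le_nhds (s := Ioi (0:ℝ)))
    refine h1.eventually (lt_mem_nhds ?_)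
    simp only [zero_mul, zero_add]
    positivity
  have hev2 : ∀ᶠ s in nhdsWithin (0:ℝ) (Ioi 0), s < t :=
    (eventually_lt_nhds h).filter_mono nhdsWithin_le_nhds
  obtain ⟨s, hs1, hs2, hs3⟩ := (hev.and (hev2.and self_mem_nhdsWithin)).exists
  have hs3 : 0 < s := hs3
  have h4 := hmono (a := s) ⟨hs3, hs2.le.trans ht⟩ ⟨h, ht⟩ hs2.le
  have : 0 < s^(2*ν) * (jM ν s * (s * jM1 ν s + ν * jM ν s)) :=
    mul_pos (Real.rpow_pos_of_pos hs3 _) hs1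
  exact (pos_iff_pos_of_mul_pos (this.trans_le h4)).1 (Real.rpow_pos_of_pos h _)

lemma jM_pos_le (ν : ℝ) (hν : 0 < ν) : ∀ t ∈ Icc 0 ν, 0 < jM ν t := by
  have h0 := jM_zero_pos ν hν.le
  have hc0 := jM_cont ν hν.le
  have hne : ∀ t ∈ Icc 0 ν, jM ν t ≠ 0 := by
    intro t ht hz
    rcases eq_or_lt_of_le ht.1 with h | h
    · rw [← h] at hz; exact h0.ne' hz
    have := jMu_pos ν hν t ⟨h, ht.2⟩
    simp [hz] at this
  intro t ht
  by_contra hcon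
  push Not at hcon
  have := intermediate_value_Icc' ht.1 (hc0.continuousOn (s := Icc 0 t))
  obtain ⟨s, hs, hs0⟩ := this ⟨hcon, h0.le⟩
  exact hne s ⟨hs.1, hs.2.trans ht.2⟩ hs0

/-- lifting of the phase -/
lemma phase_lift (l t0 : ℝ) (ht0 : l < t0) (A B A' B' : ℝ → ℝ)
    (hA : ∀ t, l < t → HasDerivAt A (A' t) t) (hB : ∀ t, l < t → HasDerivAt B (B' t) t)
    (hA' : ContinuousOn A' (Ioi l)) (hB' : ContinuousOn B' (Ioi l))
    (hnz : ∀ t, l < t → 0 < A t ^ 2 + B t ^ 2) (hpos : 0 < B t0) :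
    ∃ φ : ℝ → ℝ, (∀ t, l < t → HasDerivAt φ ((B' t * A t - A' t * B t) / (A t ^ 2 + B t ^ 2)) t) ∧
      (∀ t, l < t → B t * Real.cos (φ t) = A t * Real.sin (φ t)) ∧ 0 < φ t0 ∧ φ t0 < π := by
  set D : ℝ → ℝ := fun t => (B' t * A t - A' t * B t) / (A t ^ 2 + B t ^ 2) with hD
  have hAc : ContinuousOn A (Ioi l) := fun t ht => (hA t ht).continuousAt.continuousWithinAt
  have hBc : ContinuousOn B (Ioi l) := fun t ht => (hB t ht).continuousAt.continuousWithinAt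
  have hDc : ContinuousOn D (Ioi l) := by
    apply ContinuousOn.div
    · exact (hB'.mul hAc).sub (hA'.mul hBc)
    · exact (hAc.pow 2).add (hBc.pow 2)
    · exact fun t ht => (hnz t ht).ne'
  set z : ℂ := ⟨A t0, B t0⟩ with hz
  have hzn : 0 < ‖z‖ := by
    rw [norm_pos_iff]
    intro h
    have := congrArg Complex.im h
    simp only [hz, Complex.zero_im] at this
    exact hpos.ne' this
  have hcos := Complex.norm_mul_cos_arg z
  have hsin := Complex.norm_mul_sin_arg z
  set φ : ℝ → ℝ := fun t => Complex.arg z + ∫ s in t0..t, D s with hφ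
  have hφd : ∀ t, l < t → HasDerivAt φ (D t) t := by
    intro t ht
    apply HasDerivAt.const_add
    have hsub : uIcc t0 t ⊆ Ioi l := by
      intro s hs
      have : min t0 t ≤ s := hs.1
      exact lt_of_lt_of_le (lt_min ht0 ht) this
    exact intervalIntegral.integral_hasDerivAt_right ((hDc.mono hsub).intervalIntegrable)
      (hDc.stronglyMeasurableAtFilter isOpen_Ioi t ht) (hDc.continuousAt (Ioi_mem_nhds ht))
  have hφ0 : φ t0 = Complex.arg z := by simp [hφ]
  refine ⟨φ, hφd, ?_, ?_, ?_⟩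
  · set Y : ℝ → ℝ := fun t => (B t * Real.cos (φ t) - A t * Real.sin (φ t))^2 / (A t ^ 2 + B t ^ 2) with hY
    have hYd : ∀ t ∈ Ioi l, HasDerivAt Y 0 t := by
      intro t ht
      have hn := hnz t ht
      have h1 := (((hB t ht).mul (hφd t ht).cos).sub ((hA t ht).mul (hφd t ht).sin)).pow 2
      have h2 := ((hA t ht).pow 2).add ((hB t ht).pow 2)
      have := h1.div h2 hn.ne'
      refine this.congr_deriv ?_
      simp only [Pi.add_apply, Pi.mul_apply, Pi.pow_apply, Pi.sub_apply, hD]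
      rw [div_eq_zero_iff]
      left
      field_simp
      push_cast
      ring
    intro t ht
    have hc : Y t = Y t0 := isOpen_Ioi.is_const_of_deriv_eq_zero (convex_Ioi l).isPreconnected
      (fun s hs => (hYd s hs).differentiableAt.differentiableWithinAt)
      (fun s hs => (hYd s hs).deriv) ht ht0
    have h0 : Y t0 = 0 := by
      simp only [hY, hφ0]
      have e1 : B t0 = ‖z‖ * Real.sin z.arg := hsin.symm
      have e2 : A t0 = ‖z‖ * Real.cos z.arg := hcos.symm
      rw [e1, e2]
      ring
    rw [h0] at hc
    simp only [hY] at hc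
    rw [div_eq_zero_iff] at hc
    rcases hc with hc | hc
    · have := pow_eq_zero_iff (two_ne_zero) |>.1 hc
      linarith
    · exact absurd hc (hnz t ht).ne'
  · rw [hφ0]
    have h1 : 0 ≤ z.arg := Complex.arg_nonneg_iff.2 hpos.le
    rcases eq_or_lt_of_le h1 with h | h
    · rw [← h] at hsin
      simp only [Real.sin_zero, mul_zero, hz] at hsin
      linarith
    · exact h
  · rw [hφ0]
    refine lt_of_le_of_ne (Complex.arg_le_pi z) ?_
    intro h
    rw [h] at hsin
    simp only [Real.sin_pi, mul_zero, hz] at hsin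
    linarith

noncomputable def psi (ν t : ℝ) : ℝ := Real.sqrt (t^2 - ν^2) - ν * Real.arccos (ν/t)
noncomputable def Rr (ν t : ℝ) : ℝ :=
  1/(4*Real.sqrt (t^2 - ν^2)) + 5*ν^2/(12*(Real.sqrt (t^2 - ν^2))^3)

lemma q_facts (ν t : ℝ) (hν : 0 < ν) (ht : ν < t) :
    0 < Real.sqrt (t^2 - ν^2) ∧ (Real.sqrt (t^2 - ν^2))^2 = t^2 - ν^2 ∧
      HasDerivAt (fun t => Real.sqrt (t^2 - ν^2)) (t / Real.sqrt (t^2 - ν^2)) t := by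
  have hw : 0 < t^2 - ν^2 := by nlinarith
  refine ⟨Real.sqrt_pos.2 hw, Real.sq_sqrt hw.le, ?_⟩
  have h1 : HasDerivAt (fun t : ℝ => t^2 - ν^2) (2*t) t := by
    have := (hasDerivAt_pow 2 t).sub_const (ν^2)
    refine this.congr_deriv ?_
    simp
  have := h1.sqrt hw.ne'
  refine this.congr_deriv ?_
  have := Real.sqrt_pos.2 hw
  field_simp

lemma psi_deriv (ν t : ℝ) (hν : 0 < ν) (ht : ν < t) :
    HasDerivAt (psi ν) (Real.sqrt (t^2 - ν^2) / t) t := by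
  obtain ⟨hq, hq2, hqd⟩ := q_facts ν t hν ht
  have ht0 : 0 < t := hν.trans ht
  have h1 : HasDerivAt (fun t : ℝ => ν/t) (-ν/t^2) t := by
    have := (hasDerivAt_const t ν).div (hasDerivAt_id t) ht0.ne'
    refine this.congr_deriv ?_
    simp
  have hlt : ν/t < 1 := (div_lt_one ht0).2 ht
  have hgt : 0 < ν/t := by positivity
  have h2 := (Real.hasDerivAt_arccos (by linarith : ν/t ≠ -1) hlt.ne).comp t h1
  have := hqd.sub (h2.const_mul ν)
  refine this.congr_deriv ?_
  have e : Real.sqrt (1 - (ν/t)^2) = Real.sqrt (t^2-ν^2) / t := by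
    rw [show 1 - (ν/t)^2 = (t^2-ν^2)/t^2 by field_simp, Real.sqrt_div' _ (by positivity),
      Real.sqrt_sq ht0.le]
  rw [e]
  set q := Real.sqrt (t^2-ν^2)
  field_simp
  nlinarith

lemma Rr_deriv (ν t : ℝ) (hν : 0 < ν) (ht : ν < t) :
    HasDerivAt (Rr ν) (-(Real.sqrt (t^2 - ν^2) / t * ((t^4/4 + t^2*ν^2)/(t^2-ν^2)^3))) t := by
  obtain ⟨hq, hq2, hqd⟩ := q_facts ν t hν ht
  have ht0 : 0 < t := hν.trans ht
  have h1 := (hasDerivAt_const t (1:ℝ)).div (hqd.const_mul 4) (by positivity)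
  have h2 := (hasDerivAt_const t (5*ν^2:ℝ)).div ((hqd.pow 3).const_mul 12) (by simp only [Pi.pow_apply]; positivity)
  have := h1.add h2
  refine this.congr_deriv ?_
  simp only [Pi.pow_apply]
  clear h1 h2 this hqd
  generalize Real.sqrt (t^2 - ν^2) = q at *
  have e : t^4/4 + t^2*ν^2 = t^2 * (q^2 + 5*ν^2)/4 := by rw [hq2]; ring
  rw [← hq2, e]
  clear e hq2
  field_simp
  push_cast
  ring

lemma Rr_pos (ν t : ℝ) (hν : 0 < ν) (ht : ν < t) : 0 < Rr ν t := by
  obtain ⟨hq, -, -⟩ := q_facts ν t hν ht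
  unfold Rr
  positivity

noncomputable def kap (ν t : ℝ) : ℝ := ν/t + t/(2*(t^2-ν^2))
noncomputable def fA (ν t : ℝ) : ℝ := t / Real.sqrt (t^2 - ν^2) * (jM1 ν t + kap ν t * jM ν t)

lemma fA_deriv (ν t : ℝ) (hν : 0 < ν) (ht : ν < t) :
    HasDerivAt (fA ν) (-(Real.sqrt (t^2-ν^2)/t * (1 + (t^4/4 + t^2*ν^2)/(t^2-ν^2)^3) * jM ν t)
      - kap ν t * fA ν t) t := by
  obtain ⟨hq, hq2, hqd⟩ := q_facts ν t hν ht
  have ht0 : 0 < t := hν.trans ht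
  have hw : 0 < t^2 - ν^2 := by nlinarith
  obtain ⟨d0, d1⟩ := jM_sol ν hν.le t ht0
  have hk : HasDerivAt (kap ν) (-ν/t^2 + (2*(t^2-ν^2) - 4*t^2)/(2*(t^2-ν^2))^2) t := by
    have h1 : HasDerivAt (fun t : ℝ => ν/t) (-ν/t^2) t := by
      have := (hasDerivAt_const t ν).div (hasDerivAt_id t) ht0.ne'
      refine this.congr_deriv ?_
      simp
    have h2 : HasDerivAt (fun t : ℝ => 2*(t^2-ν^2)) (4*t) t := by
      have := ((hasDerivAt_pow 2 t).sub_const (ν^2)).const_mul 2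
      refine this.congr_deriv ?_
      push_cast; ring
    have := h1.add ((hasDerivAt_id t).div h2 (by positivity))
    refine this.congr_deriv ?_
    simp only [id]
    ring
  have := ((hasDerivAt_id t).div hqd hq.ne').mul (d1.add (hk.mul d0))
  refine this.congr_deriv ?_
  simp only [Pi.add_apply, Pi.mul_apply, Pi.div_apply, id, fA, kap]
  clear d0 d1 hk this hqd hw
  generalize Real.sqrt (t^2 - ν^2) = q at *
  rw [← hq2]
  generalize jM ν t = M at *
  generalize jM1 ν t = M1 at *
  field_simp
  linear_combination (4 * M * (4 * q^4 - 4 * t^2) + 32 * t^2 * M) * hq2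

lemma jM1_eq (ν t : ℝ) (hν : 0 < ν) (ht : ν < t) :
    jM1 ν t = Real.sqrt (t^2-ν^2)/t * fA ν t - kap ν t * jM ν t := by
  obtain ⟨hq, hq2, hqd⟩ := q_facts ν t hν ht
  have ht0 : 0 < t := hν.trans ht
  unfold fA
  field_simp
  ring

-- SECTION D
lemma jM_pos_star (ν qs : ℝ) (hν : 0 < ν) (hqs : 0 < qs) (h3 : qs^3 = ν^2) :
    ∀ t, 0 ≤ t → t^2 ≤ ν^2 + qs^2 → 0 < jM ν t := by
  intro t1 ht1 ht2
  by_contra hcon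
  push Not at hcon
  have hle := jM_pos_le ν hν
  have hc0 := jM_cont ν hν.le
  have hνt : ν < t1 := by
    by_contra hc
    push Not at hc
    exact absurd (hle t1 ⟨ht1, hc⟩) (not_lt.2 hcon)
  have hK : IsCompact (Icc ν t1 ∩ {s | jM ν s ≤ 0}) :=
    isCompact_Icc.inter_right (isClosed_le hc0 continuous_const)
  obtain ⟨z, ⟨hz1, hz2⟩, hzl⟩ := hK.exists_isLeast ⟨t1, ⟨hνt.le, le_rfl⟩, hcon⟩
  have hz2 : jM ν z ≤ 0 := hz2
  have hνz : ν < z := by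
    by_contra hc
    push Not at hc
    exact absurd (hle z ⟨hν.le.trans hz1.1, hc⟩) (not_lt.2 hz2)
  have hpos : ∀ s, ν ≤ s → s < z → 0 < jM ν s := by
    intro s h1 h2
    by_contra hc
    push Not at hc
    exact absurd (hzl ⟨⟨h1, h2.le.trans hz1.2⟩, hc⟩) (not_le.2 h2)
  have hzq : z^2 ≤ ν^2 + qs^2 := by nlinarith [hz1.2, hz1.1]
  set c : ℝ := 1/(8*qs^4) with hc
  have hcpos : 0 < c := by positivity
  have hc8 : 8*c*ν^4 = qs^2 := by
    rw [hc, show ν^4 = (ν^2)^2 by ring, ← h3]; field_simp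
  have hcq : c * qs^4 = 1/8 := by rw [hc]; field_simp
  have hv : ∀ s, ν ≤ s → s ≤ z → 0 < 1 - c*(s^2-ν^2)^2 := by
    intro s h1 h2
    have a1 : 0 ≤ s^2 - ν^2 := by nlinarith
    have a2 : s^2 - ν^2 ≤ qs^2 := by nlinarith
    have : (s^2-ν^2)^2 ≤ (qs^2)^2 := pow_le_pow_left₀ a1 a2 2
    nlinarith
  have hpw : ∀ s, 0 < s → HasDerivAt (fun s : ℝ => s^ν) (ν * s^ν / s) s := by
    intro s hs
    have := Real.hasDerivAt_rpow_const (p := ν) (Or.inl hs.ne')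
    refine this.congr_deriv ?_
    rw [Real.rpow_sub_one hs.ne']; ring
  have hvd : ∀ s, HasDerivAt (fun s : ℝ => 1 - c*(s^2-ν^2)^2) (-(4*c*s*(s^2-ν^2))) s := by
    intro s
    have := ((((hasDerivAt_pow 2 s).sub_const (ν^2)).pow 2).const_mul c).const_sub 1
    refine this.congr_deriv ?_
    simp
    ring
  have hwd : ∀ s, HasDerivAt (fun s : ℝ => 4*c*s^2*(s^2-ν^2)) (8*c*s*(s^2-ν^2) + 8*c*s^3) s := by
    intro s
    have := ((hasDerivAt_pow 2 s).const_mul (4*c)).mul ((hasDerivAt_pow 2 s).sub_const (ν^2))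
    refine this.congr_deriv ?_
    simp
    ring
  set W : ℝ → ℝ := fun s => s^ν * ((s * jM1 ν s + ν * jM ν s) * (1 - c*(s^2-ν^2)^2)
      + jM ν s * (4*c*s^2*(s^2-ν^2))) with hW
  have hWd : ∀ s, 0 < s → HasDerivAt W (s^ν / s * jM ν s *
      (8*c*s^2*(s^2-ν^2) + 8*c*s^4 - (s^2-ν^2)*(1 - c*(s^2-ν^2)^2))) s := by
    intro s hs
    obtain ⟨d0, d1⟩ := jM_sol ν hν.le s hs
    have := (hpw s hs).mul (((((hasDerivAt_id s).mul d1).add (d0.const_mul ν)).mul (hvd s)).add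
      (d0.mul (hwd s)))
    refine this.congr_deriv ?_
    simp only [Pi.add_apply, Pi.mul_apply, id]
    field_simp
    ring
  have hWm : MonotoneOn W (Icc ν z) := by
    apply monotoneOn_of_deriv_nonneg (convex_Icc ν z)
    · exact fun t ht => (hWd t (hν.trans_le ht.1)).continuousAt.continuousWithinAt
    · intro t ht
      rw [interior_Icc] at ht
      exact (hWd t (hν.trans ht.1)).differentiableAt.differentiableWithinAt
    · intro t ht
      rw [interior_Icc] at ht
      have ht0 : 0 < t := hν.trans ht.1
      rw [(hWd t ht0).deriv]
      have h1 : 0 < jM ν t := hpos t ht.1.le ht.2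
      have hp : 0 < t^ν := Real.rpow_pos_of_pos ht0 _
      have a1 : 0 ≤ t^2 - ν^2 := by nlinarith [ht.1]
      have a2 : t^2 - ν^2 ≤ qs^2 := by nlinarith [ht.2]
      have a3 : 0 ≤ 8*c*t^2*(t^2-ν^2) + 8*c*t^4 - (t^2-ν^2)*(1 - c*(t^2-ν^2)^2) := by
        have b1 : ν^4 ≤ t^4 := pow_le_pow_left₀ hν.le ht.1.le 4
        have b2 : 8*c*ν^4 ≤ 8*c*t^4 := by gcongr
        have b3 : 0 ≤ 8*c*t^2*(t^2-ν^2) := by positivity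
        have b4 : 0 ≤ (t^2-ν^2)*(c*(t^2-ν^2)^2) := by positivity
        nlinarith
      positivity
  have hWν : 0 < W ν := by
    have h1 := jMu_pos ν hν ν ⟨hν, le_rfl⟩
    have h2 := hle ν ⟨hν.le, le_rfl⟩
    have h3 := (pos_iff_pos_of_mul_pos h1).1 h2
    simp only [hW, sub_self]
    have : 0 < ν^ν := Real.rpow_pos_of_pos hν _
    simp
    positivity
  have hGd : ∀ s ∈ Icc ν z, HasDerivAt (fun s => s^ν * jM ν s / (1 - c*(s^2-ν^2)^2))
      (W s / (s * (1 - c*(s^2-ν^2)^2)^2)) s := by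
    intro s hs
    have hs0 : 0 < s := hν.trans_le hs.1
    obtain ⟨d0, d1⟩ := jM_sol ν hν.le s hs0
    have hv1 := hv s hs.1 hs.2
    have := ((hpw s hs0).mul d0).div (hvd s) hv1.ne'
    refine this.congr_deriv ?_
    simp only [Pi.mul_apply, hW]
    field_simp
    ring
  have hGm : MonotoneOn (fun s => s^ν * jM ν s / (1 - c*(s^2-ν^2)^2)) (Icc ν z) := by
    apply monotoneOn_of_deriv_nonneg (convex_Icc ν z)
    · exact fun t ht => (hGd t ht).continuousAt.continuousWithinAt
    · intro t ht
      exact (hGd t (interior_subset ht)).differentiableAt.differentiableWithinAt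
    · intro t ht
      have ht := interior_subset ht
      rw [(hGd t ht).deriv]
      have h1 := hWm ⟨le_rfl, hνz.le⟩ ht ht.1
      have h2 := hv t ht.1 ht.2
      have h3 : 0 < t := hν.trans_le ht.1
      have : 0 < W t := hWν.trans_le h1
      positivity
  have h1 := hGm ⟨le_rfl, hνz.le⟩ ⟨hνz.le, le_rfl⟩ hνz.le
  have h2 := hle ν ⟨hν.le, le_rfl⟩
  have hp : 0 < ν^ν := Real.rpow_pos_of_pos hν _
  have hpz : 0 < z^ν := Real.rpow_pos_of_pos (hν.trans hνz) _
  simp only [sub_self] at h1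
  have h4 : 0 < ν^ν * jM ν ν / (1 - c*0^2) := by simp; positivity
  have h5 : z^ν * jM ν z / (1 - c*(z^2-ν^2)^2) ≤ 0 :=
    div_nonpos_of_nonpos_of_nonneg (mul_nonpos_of_nonneg_of_nonpos hpz.le hz2) (hv z hνz.le le_rfl).le
  linarith

lemma psi_bounds (ν t : ℝ) (hν : 0 < ν) (ht : ν ≤ t) :
    0 ≤ psi ν t ∧ psi ν t ≤ (Real.sqrt (t^2-ν^2))^3 / (3*ν^2) := by
  have hcont : ContinuousOn (psi ν) (Ici ν) := by
    unfold psi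
    refine ContinuousOn.sub (by fun_prop) (ContinuousOn.mul continuousOn_const ?_)
    refine Real.continuous_arccos.comp_continuousOn ?_
    exact ContinuousOn.div continuousOn_const continuousOn_id (fun s hs => (hν.trans_le hs).ne')
  have h0 : psi ν ν = 0 := by simp [psi, hν.ne']
  have m1 : MonotoneOn (psi ν) (Ici ν) := by
    apply monotoneOn_of_deriv_nonneg (convex_Ici ν) hcont
    · intro s hs
      rw [interior_Ici] at hs
      exact (psi_deriv ν s hν hs).differentiableAt.differentiableWithinAt
    · intro s hs
      rw [interior_Ici] at hs
      have : 0 < s := hν.trans hs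
      rw [(psi_deriv ν s hν hs).deriv]; positivity
  have hd : ∀ s, ν < s → HasDerivAt (fun s => (Real.sqrt (s^2-ν^2))^3 / (3*ν^2) - psi ν s)
      (Real.sqrt (s^2-ν^2) * s / ν^2 - Real.sqrt (s^2-ν^2) / s) s := by
    intro s hs
    obtain ⟨hq, hq2, hqd⟩ := q_facts ν s hν hs
    have := ((hqd.pow 3).div_const (3*ν^2)).sub (psi_deriv ν s hν hs)
    refine this.congr_deriv ?_
    generalize Real.sqrt (s^2 - ν^2) = q at *
    field_simp
    push_cast
    ring
  have m2 : MonotoneOn (fun s => (Real.sqrt (s^2-ν^2))^3 / (3*ν^2) - psi ν s) (Ici ν) := by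
    apply monotoneOn_of_deriv_nonneg (convex_Ici ν)
    · exact ContinuousOn.sub (by fun_prop) hcont
    · intro s hs
      rw [interior_Ici] at hs
      exact (hd s hs).differentiableAt.differentiableWithinAt
    · intro s hs
      rw [interior_Ici] at hs
      have hs' : ν < s := hs
      have hs0 : 0 < s := hν.trans hs
      rw [(hd s hs).deriv]
      have hq : 0 ≤ Real.sqrt (s^2-ν^2) := Real.sqrt_nonneg _
      have : Real.sqrt (s^2-ν^2) * s / ν^2 - Real.sqrt (s^2-ν^2) / s
        = Real.sqrt (s^2-ν^2) * ((s^2-ν^2) / (s*ν^2)) := by field_simp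
      rw [this]
      have : 0 ≤ s^2 - ν^2 := by nlinarith
      positivity
  have a := m1 (mem_Ici.2 le_rfl) ht ht
  have b := m2 (mem_Ici.2 le_rfl) ht ht
  simp [h0] at a b
  exact ⟨a, b⟩

lemma psi_mono (ν : ℝ) (hν : 0 < ν) : StrictMonoOn (psi ν) (Ioi ν) := by
  apply strictMonoOn_of_deriv_pos (convex_Ioi ν)
  · exact fun s hs => (psi_deriv ν s hν hs).continuousAt.continuousWithinAt
  · intro s hs
    rw [interior_Ioi] at hs
    have : 0 < s := hν.trans hs
    have := (q_facts ν s hν hs).1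
    rw [(psi_deriv ν s hν hs).deriv]; positivity

lemma psi_asymp (ν : ℝ) (hν : 0 < ν) :
    Tendsto (fun t => psi ν t - (t - π*ν/2)) atTop (nhds 0) := by
  have h1 : Tendsto (fun t : ℝ => ν/t) atTop (nhds 0) := tendsto_const_nhds.div_atTop tendsto_id
  have h2 : Tendsto (fun t : ℝ => Real.arccos (ν/t)) atTop (nhds (π/2)) := by
    have := (Real.continuous_arccos.tendsto 0).comp h1
    simpa [Function.comp_def] using this
  have h3 : Tendsto (fun t : ℝ => Real.sqrt (t^2-ν^2) - t) atTop (nhds 0) := by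
    have h4 : Tendsto (fun t : ℝ => -(ν^2/t)) atTop (nhds 0) := by
      have := (tendsto_const_nhds (x := ν^2)).div_atTop tendsto_id (l := atTop (α := ℝ))
      simpa using this.neg
    refine tendsto_of_tendsto_of_tendsto_of_le_of_le' h4 tendsto_const_nhds ?_ ?_
    · filter_upwards [eventually_gt_atTop ν] with t ht
      have ht0 : 0 < t := hν.trans ht
      have : t - ν^2/t ≤ Real.sqrt (t^2-ν^2) := by
        apply Real.le_sqrt_of_sq_le
        have e : (t - ν^2/t)^2 = t^2 - ν^2 - ν^2*(t^2-ν^2)/t^2 := by field_simp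
        rw [e]
        have : 0 ≤ t^2 - ν^2 := by nlinarith
        have : 0 ≤ ν^2*(t^2-ν^2)/t^2 := by positivity
        linarith
      linarith
    · filter_upwards [eventually_gt_atTop ν] with t ht
      have ht0 : 0 < t := hν.trans ht
      have : Real.sqrt (t^2-ν^2) ≤ t := by
        apply Real.sqrt_le_iff.2 ⟨ht0.le, by nlinarith⟩
      linarith
  have := h3.sub (h2.const_mul ν)
  have h5 := this.add_const (π*ν/2)
  have e : (0 - ν*(π/2)) + π*ν/2 = 0 := by ring
  rw [e] at h5
  refine h5.congr (fun t => ?_)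
  unfold psi; ring

-- SECTION E
lemma phase_exists (ν t0 : ℝ) (hν : 0 < ν) (ht0 : ν < t0) (hp : 0 < jM ν t0) :
    ∃ φ s : ℝ → ℝ, 0 < φ t0 ∧ φ t0 < π ∧ (∀ t, ν < t → (jM ν t = 0 ↔ sin (φ t) = 0)) ∧
      (∀ t, ν < t → 0 ≤ s t ∧ s t ≤ 1 ∧ HasDerivAt φ (Real.sqrt (t^2-ν^2)/t *
        (1 + (t^4/4 + t^2*ν^2)/(t^2-ν^2)^3 * s t)) t) := by
  have hc0 := jM_cont ν hν.le
  have hc1 := jM1_cont ν hν.le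
  have hcA : ContinuousOn (fA ν) (Ioi ν) :=
    fun t ht => (fA_deriv ν t hν ht).continuousAt.continuousWithinAt
  have hw : ∀ t ∈ Ioi ν, t^2 - ν^2 ≠ 0 := by
    intro t ht
    have : ν < t := ht
    nlinarith
  have hz : ∀ t ∈ Ioi ν, t ≠ 0 := fun t ht => (hν.trans ht).ne'
  have hck : ContinuousOn (kap ν) (Ioi ν) := by
    unfold kap
    refine ContinuousOn.add (ContinuousOn.div continuousOn_const continuousOn_id hz)
      (ContinuousOn.div continuousOn_id (by fun_prop) (fun t ht => mul_ne_zero two_ne_zero (hw t ht)))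
  have hnz : ∀ t, ν < t → 0 < (fA ν t)^2 + (jM ν t)^2 := by
    intro t ht
    by_contra hcon
    have h1 : jM ν t = 0 := by nlinarith [sq_nonneg (fA ν t), sq_nonneg (jM ν t)]
    have h2 : fA ν t = 0 := by nlinarith [sq_nonneg (fA ν t), sq_nonneg (jM ν t)]
    have h3 := jM1_eq ν t hν ht
    rw [h1, h2] at h3
    exact msol_simple ν hν.le t (hν.trans ht) h1 (by simpa using h3)
  obtain ⟨φ, hφ1, hφ2, hφ3, hφ4⟩ := phase_lift ν t0 ht0 (fA ν) (jM ν)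
    (fun t => -(Real.sqrt (t^2-ν^2)/t * (1 + (t^4/4 + t^2*ν^2)/(t^2-ν^2)^3) * jM ν t)
      - kap ν t * fA ν t) (jM1 ν) (fun t ht => fA_deriv ν t hν ht)
    (fun t ht => (jM_sol ν hν.le t (hν.trans ht)).1)
    (by
      refine ContinuousOn.sub (ContinuousOn.neg (ContinuousOn.mul (ContinuousOn.mul ?_ ?_)
        hc0.continuousOn)) (hck.mul hcA)
      · exact ContinuousOn.div (by fun_prop) continuousOn_id hz
      · exact continuousOn_const.add (ContinuousOn.div (by fun_prop) (by fun_prop)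
          (fun t ht => pow_ne_zero 3 (hw t ht))))
    hc1.continuousOn hnz hp
  refine ⟨φ, fun t => (jM ν t)^2/((fA ν t)^2 + (jM ν t)^2), hφ3, hφ4, ?_, ?_⟩
  · intro t ht
    have h := hφ2 t ht
    have hn := hnz t ht
    have hsc := Real.sin_sq_add_cos_sq (φ t)
    constructor
    · intro h0
      rw [h0] at h hn
      have : fA ν t ≠ 0 := by rintro h; simp [h] at hn
      have h' : fA ν t * sin (φ t) = 0 := by linarith
      exact (mul_eq_zero.1 h').resolve_left this
    · intro h0
      rw [h0] at h hsc
      have : cos (φ t) ≠ 0 := by rintro h; simp [h] at hsc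
      have h' : jM ν t * cos (φ t) = 0 := by linarith
      exact (mul_eq_zero.1 h').resolve_right this
  · intro t ht
    have hn := hnz t ht
    refine ⟨by positivity, ?_, ?_⟩
    · rw [div_le_one hn]; nlinarith [sq_nonneg (fA ν t)]
    · refine (hφ1 t ht).congr_deriv ?_
      rw [jM1_eq ν t hν ht]
      simp only []
      generalize fA ν t = A at *
      generalize jM ν t = B at *
      generalize (t^4/4 + t^2*ν^2)/(t^2-ν^2)^3 = r
      have := hz t ht
      field_simp
      ring

lemma phase_mono (ν t0 : ℝ) (hν : 0 < ν) (ht0 : ν < t0) (hp : 0 < jM ν t0) :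
    ∃ φ : ℝ → ℝ, 0 < φ t0 ∧ φ t0 < π ∧ (∀ t, ν < t → (jM ν t = 0 ↔ sin (φ t) = 0)) ∧
      ContinuousOn φ (Ioi ν) ∧ StrictMonoOn φ (Ioi ν) ∧
      MonotoneOn (fun t => φ t - psi ν t) (Ioi ν) ∧
      AntitoneOn (fun t => φ t - psi ν t + Rr ν t) (Ioi ν) := by
  obtain ⟨φ, s, h1, h2, h3, h4⟩ := phase_exists ν t0 hν ht0 hp
  have hr : ∀ t, ν < t → 0 ≤ (t^4/4 + t^2*ν^2)/(t^2-ν^2)^3 := by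
    intro t ht
    have : 0 < t^2 - ν^2 := by nlinarith
    positivity
  have hq : ∀ t, ν < t → 0 < Real.sqrt (t^2-ν^2)/t := by
    intro t ht
    exact div_pos (q_facts ν t hν ht).1 (hν.trans ht)
  refine ⟨φ, h1, h2, h3, fun t ht => (h4 t ht).2.2.continuousAt.continuousWithinAt, ?_, ?_, ?_⟩
  · apply strictMonoOn_of_deriv_pos (convex_Ioi ν)
    · exact fun t ht => (h4 t ht).2.2.continuousAt.continuousWithinAt
    · intro t ht
      rw [interior_Ioi] at ht
      obtain ⟨a, b, c⟩ := h4 t ht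
      rw [c.deriv]
      have := hr t ht
      have := hq t ht
      positivity
  · have hd : ∀ t, ν < t → HasDerivAt (fun t => φ t - psi ν t)
      (Real.sqrt (t^2-ν^2)/t * ((t^4/4 + t^2*ν^2)/(t^2-ν^2)^3 * s t)) t := by
      intro t ht
      have := (h4 t ht).2.2.sub (psi_deriv ν t hν ht)
      refine this.congr_deriv ?_
      ring
    apply monotoneOn_of_deriv_nonneg (convex_Ioi ν)
    · exact fun t ht => (hd t ht).continuousAt.continuousWithinAt
    · intro t ht
      rw [interior_Ioi] at ht
      exact (hd t ht).differentiableAt.differentiableWithinAt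
    · intro t ht
      rw [interior_Ioi] at ht
      rw [(hd t ht).deriv]
      have := hr t ht
      have := hq t ht
      have := (h4 t ht).1
      positivity
  · have hd : ∀ t, ν < t → HasDerivAt (fun t => φ t - psi ν t + Rr ν t)
      (-(Real.sqrt (t^2-ν^2)/t * ((t^4/4 + t^2*ν^2)/(t^2-ν^2)^3 * (1 - s t)))) t := by
      intro t ht
      have := ((h4 t ht).2.2.sub (psi_deriv ν t hν ht)).add (Rr_deriv ν t hν ht)
      refine this.congr_deriv ?_
      ring
    apply antitoneOn_of_deriv_nonpos (convex_Ioi ν)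
    · exact fun t ht => (hd t ht).continuousAt.continuousWithinAt
    · intro t ht
      rw [interior_Ioi] at ht
      exact (hd t ht).differentiableAt.differentiableWithinAt
    · intro t ht
      rw [interior_Ioi] at ht
      rw [(hd t ht).deriv]
      have := hr t ht
      have := hq t ht
      have := (h4 t ht).2.1
      have : 0 ≤ 1 - s t := by linarith
      rw [neg_nonpos]
      positivity

-- SECTION F
lemma qs_exists (ν : ℝ) (hν : 1 ≤ ν) : ∃ qs : ℝ, 1 ≤ qs ∧ qs^3 = ν^2 := by
  have h0 : 0 ≤ ν^2 := by positivity
  refine ⟨(ν^2)^((1:ℝ)/3), Real.one_le_rpow (by nlinarith) (by norm_num), ?_⟩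
  rw [← Real.rpow_natCast, ← Real.rpow_mul h0]
  norm_num

lemma psi_le_self (ν t : ℝ) (hν : 0 < ν) (ht : ν < t) : psi ν t ≤ t := by
  have h1 : 0 ≤ Real.arccos (ν/t) := Real.arccos_nonneg _
  have h2 : Real.sqrt (t^2-ν^2) ≤ t := Real.sqrt_le_iff.2 ⟨(hν.trans ht).le, by nlinarith⟩
  unfold psi
  nlinarith [mul_nonneg hν.le h1]

lemma psi_tendsto (ν : ℝ) (hν : 0 < ν) : Tendsto (psi ν) atTop atTop := by
  have h1 : Tendsto (fun t : ℝ => t - π*ν/2) atTop atTop :=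
    tendsto_atTop_add_const_right _ _ tendsto_id
  have := (psi_asymp ν hν).add_atTop h1
  refine this.congr (fun t => ?_)
  ring

lemma zero_bound (ν : ℝ) (hν1 : 1 ≤ ν) (j : ℕ → ℝ) (hpos : ∀ k, 1 ≤ k → 0 < j k)
    (hmono : ∀ k l, 1 ≤ k → k < l → j k < j l) (hzero : ∀ k, 1 ≤ k → jM ν (j k) = 0)
    (hall : ∀ z, 0 < z → jM ν z = 0 → ∃ k, 1 ≤ k ∧ j k = z) :
    ∀ k : ℕ, 1 ≤ k → ν < j k ∧ k * π - π/4 ≤ psi ν (j k) ∧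
      psi ν (j k) ≤ k * π - π/4 + Rr ν (j k) := by
  have hν : 0 < ν := by linarith
  obtain ⟨qs, hqs1, hqs3⟩ := qs_exists ν hν1
  have hqs : 0 < qs := by linarith
  set t0 := Real.sqrt (ν^2+qs^2) with ht0
  have ht0s : t0^2 = ν^2+qs^2 := Real.sq_sqrt (by positivity)
  have ht0p : 0 < t0 := Real.sqrt_pos.2 (by positivity)
  have hνt0 : ν < t0 := Real.lt_sqrt_of_sq_lt (by nlinarith)
  have hstar := jM_pos_star ν qs hν hqs hqs3
  have hqt : Real.sqrt (t0^2-ν^2) = qs := by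
    rw [ht0s, add_sub_cancel_left, Real.sqrt_sq hqs.le]
  obtain ⟨hpsi0, hpsi1⟩ := psi_bounds ν t0 hν hνt0.le
  have hpsi3 : psi ν t0 ≤ 1/3 := by
    rw [hqt, hqs3] at hpsi1
    refine hpsi1.trans (le_of_eq ?_)
    field_simp
  have hRr : Rr ν t0 ≤ 2/3 := by
    unfold Rr
    rw [hqt, hqs3]
    have h1 : 1/(4*qs) ≤ 1/4 := by
      apply one_div_le_one_div_of_le <;> linarith
    have h2 : 5*ν^2/(12*ν^2) = 5/12 := by field_simp
    rw [h2]; linarith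
  obtain ⟨φ, hφ0, hφπ, hφz, hφc, hφm, hgm, hga⟩ := phase_mono ν t0 hν hνt0
    (hstar t0 ht0p.le ht0s.le)
  have hjt : ∀ k, 1 ≤ k → t0 < j k := by
    intro k hk
    by_contra hc
    push Not at hc
    have := hstar (j k) (hpos k hk).le (by nlinarith [hpos k hk])
    exact this.ne' (hzero k hk)
  have hjν : ∀ k, 1 ≤ k → ν < j k := fun k hk => hνt0.trans (hjt k hk)
  -- levels
  have hlev : ∀ i : ℕ, ∃ n : ℕ, φ (j (i+1)) = ((n:ℝ)+1) * π := by
    intro i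
    have h1 := (hφz _ (hjν (i+1) (by omega))).1 (hzero (i+1) (by omega))
    obtain ⟨n, hn⟩ := Real.sin_eq_zero_iff.1 h1
    have h2 : 0 < φ (j (i+1)) := hφ0.trans (hφm hνt0 (hjν (i+1) (by omega)) (hjt (i+1) (by omega)))
    have h3 : 0 < n := by
      rw [← hn] at h2
      have := (pos_iff_pos_of_mul_pos h2).2 Real.pi_pos
      exact_mod_cast this
    refine ⟨(n-1).toNat, ?_⟩
    have : (((n-1).toNat : ℤ) : ℝ) = ((n - 1 : ℤ) : ℝ) := by
      rw [Int.toNat_of_nonneg (by omega)]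
    push_cast at this
    rw [this, ← hn]; ring
  choose L hL using hlev
  have hLm : StrictMono L := by
    intro a b hab
    have h1 := hφm (hjν (a+1) (by omega)) (hjν (b+1) (by omega)) (hmono (a+1) (b+1) (by omega) (by omega))
    rw [hL, hL] at h1
    have h2 := lt_of_mul_lt_mul_right h1 Real.pi_pos.le
    have h3 : (L a : ℝ) < L b := by linarith
    exact_mod_cast h3
  have hLs : Function.Surjective L := by
    intro m
    have hev : ∀ᶠ t in atTop, ((m:ℝ)+1)*π ≤ φ t := by
      filter_upwards [(psi_tendsto ν hν).eventually_ge_atTop (((m:ℝ)+1)*π - (φ t0 - psi ν t0)),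
        eventually_ge_atTop t0] with t h1 h2
      have := hgm hνt0 (hνt0.trans_le h2) h2
      simp only at this
      linarith
    obtain ⟨T, hT1, hT2⟩ := (hev.and (eventually_ge_atTop t0)).exists
    have hsub : Icc t0 T ⊆ Ioi ν := fun s hs => hνt0.trans_le hs.1
    have hm0 : (0:ℝ) ≤ m := Nat.cast_nonneg m
    obtain ⟨z, hz1, hz2⟩ := intermediate_value_Icc hT2 (hφc.mono hsub)
      (show ((m:ℝ)+1)*π ∈ Icc (φ t0) (φ T) from ⟨by nlinarith [Real.pi_pos], hT1⟩)
    have hzν : ν < z := hsub hz1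
    have hz0 : jM ν z = 0 := by
      rw [hφz z hzν, hz2]
      have := Real.sin_nat_mul_pi (m+1)
      push_cast at this
      exact this
    obtain ⟨k, hk, hjk⟩ := hall z (hν.trans hzν) hz0
    obtain ⟨i, rfl⟩ : ∃ i, k = i + 1 := ⟨k-1, by omega⟩
    refine ⟨i, ?_⟩
    have := hL i
    rw [hjk, hz2] at this
    have h2 := mul_right_cancel₀ Real.pi_pos.ne' this
    have h3 : (L i : ℝ) = m := by linarith
    exact_mod_cast h3
  have hLid : L = id := by
    refine (StrictMono.range_inj hLm strictMono_id).1 ?_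
    rw [hLs.range_eq]; simp
  have hφj : ∀ i : ℕ, φ (j (i+1)) = ((i:ℝ)+1) * π := by
    intro i
    rw [hL i, hLid]; simp
  -- limit of g
  set G : ℕ → ℝ := fun n => φ (j (n+1)) - psi ν (j (n+1)) with hG
  have hjle : ∀ a b : ℕ, a ≤ b → j (a+1) ≤ j (b+1) := by
    intro a b hab
    rcases eq_or_lt_of_le hab with h | h
    · rw [h]
    · exact (hmono _ _ (by omega) (by omega)).le
  have hGm : Monotone G := fun a b hab =>
    hgm (hjν (a+1) (by omega)) (hjν (b+1) (by omega)) (hjle a b hab)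
  have hGlow : ∀ n, φ t0 - psi ν t0 ≤ G n := fun n =>
    hgm hνt0 (hjν (n+1) (by omega)) (hjt (n+1) (by omega)).le
  have hGa : ∀ a b : ℕ, a ≤ b → G b ≤ G a + Rr ν (j (a+1)) := by
    intro a b hab
    have h1 := hga (hjν (a+1) (by omega)) (hjν (b+1) (by omega)) (hjle a b hab)
    have h2 := Rr_pos ν _ hν (hjν (b+1) (by omega))
    simp only at h1
    simp only [hG]
    linarith
  have hGup : ∀ n, G n ≤ φ t0 - psi ν t0 + Rr ν t0 := by
    intro n
    have h1 := hga hνt0 (hjν (n+1) (by omega)) (hjt (n+1) (by omega)).le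
    have h2 := Rr_pos ν _ hν (hjν (n+1) (by omega))
    simp only at h1
    simp only [hG]
    linarith
  obtain ⟨g, hg⟩ : ∃ g, Tendsto G atTop (nhds g) :=
    ⟨_, tendsto_atTop_ciSup hGm ⟨_, by rintro _ ⟨n, rfl⟩; exact hGup n⟩⟩
  have hgG : ∀ n, G n ≤ g := fun n => hGm.ge_of_tendsto hg n
  have hgR : ∀ n, g ≤ G n + Rr ν (j (n+1)) := by
    intro n
    refine le_of_tendsto hg ?_
    filter_upwards [eventually_ge_atTop n] with b hb using hGa n b hb
  have hglow : φ t0 - psi ν t0 ≤ g := (hGlow 0).trans (hgG 0)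
  have hgup : g ≤ φ t0 - psi ν t0 + Rr ν t0 := le_of_tendsto' hg hGup
  have hjinf : Tendsto (fun n : ℕ => j (n+1)) atTop atTop := by
    have h1 : Tendsto (fun n : ℕ => ((n:ℝ)+1)*π - g) atTop atTop := by
      refine tendsto_atTop_add_const_right _ _ ?_
      refine Tendsto.atTop_mul_const Real.pi_pos ?_
      exact tendsto_atTop_add_const_right _ _ tendsto_natCast_atTop_atTop
    refine tendsto_atTop_mono (fun n => ?_) h1
    have h2 := psi_le_self ν _ hν (hjν (n+1) (by omega))
    have h3 := hgG n
    simp only [hG, hφj] at h3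
    linarith
  have hs := zeros_sin ν (by linarith) (fun n => j (n+1)) hjinf (fun n _ => hzero (n+1) (by omega))
  have hps := (psi_asymp ν hν).comp hjinf
  have hlim : Tendsto (fun n : ℕ => (sin (π/4 - G n - (psi ν (j (n+1)) - (j (n+1) - π*ν/2))))^2)
      atTop (nhds ((sin (π/4 - g - 0))^2)) := by
    refine Tendsto.pow ?_ 2
    refine (Real.continuous_sin.tendsto _).comp ?_
    exact (tendsto_const_nhds.sub hg).sub hps
  have hlim2 : Tendsto (fun n : ℕ => (sin (π/4 - G n - (psi ν (j (n+1)) - (j (n+1) - π*ν/2))))^2)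
      atTop (nhds (0^2)) := by
    refine (hs.pow 2).congr (fun n => ?_)
    have e : j (n+1) - π*ν/2 + π/4
        = (π/4 - G n - (psi ν (j (n+1)) - (j (n+1) - π*ν/2))) + ((n+1:ℕ):ℝ)*π := by
      simp only [hG, hφj]; push_cast; ring
    rw [e, Real.sin_add_nat_mul_pi, mul_pow, ← pow_mul, mul_comm (n+1) 2, pow_mul]
    simp
  have h0 := tendsto_nhds_unique hlim hlim2
  have hsin : sin (π/4 - g) = 0 := by simpa using h0
  obtain ⟨m, hm⟩ := Real.sin_eq_zero_iff.1 hsin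
  have hπ := Real.pi_gt_three
  have hm1 : m < 1 := by
    by_contra hc
    push Not at hc
    have : (1:ℝ) ≤ m := by exact_mod_cast hc
    nlinarith
  have hm2 : -1 < m := by
    by_contra hc
    push Not at hc
    have : (m:ℝ) ≤ -1 := by exact_mod_cast hc
    nlinarith
  have hm0 : m = 0 := by omega
  have hgv : g = π/4 := by
    rw [hm0] at hm
    simp at hm
    linarith
  intro k hk
  obtain ⟨i, rfl⟩ : ∃ i, k = i + 1 := ⟨k-1, by omega⟩
  have a1 := hgG i
  have a2 := hgR i
  simp only [hG, hφj] at a1 a2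
  push_cast
  exact ⟨hjν _ hk, by linarith, by linarith⟩

-- SECTION G
lemma psi_scale (ν y : ℝ) (hν : 0 < ν) : psi ν (ν*y) = ν * psi 1 y := by
  unfold psi
  have h1 : Real.sqrt ((ν*y)^2-ν^2) = ν * Real.sqrt (y^2-1^2) := by
    rw [show (ν*y)^2-ν^2 = ν^2*(y^2-1^2) by ring, Real.sqrt_mul (by positivity), Real.sqrt_sq hν.le]
  have h2 : ν/(ν*y) = 1/y := by
    rw [div_mul_eq_div_div, div_self hν.ne']
  rw [h1, h2]; ring

lemma Rr_scale (ν y : ℝ) (hν : 0 < ν) : Rr ν (ν*y) = Rr 1 y / ν := by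
  unfold Rr
  have h1 : Real.sqrt ((ν*y)^2-ν^2) = ν * Real.sqrt (y^2-1^2) := by
    rw [show (ν*y)^2-ν^2 = ν^2*(y^2-1^2) by ring, Real.sqrt_mul (by positivity), Real.sqrt_sq hν.le]
  rw [h1]
  generalize Real.sqrt (y^2-1^2) = q
  by_cases hq : q = 0
  · simp [hq]
  · field_simp

lemma Rr_anti (b y : ℝ) (hb : 1 < b) (hy : b ≤ y) : Rr 1 y ≤ Rr 1 b := by
  have h1 : 0 < Real.sqrt (b^2-1^2) := Real.sqrt_pos.2 (by nlinarith)
  have h2 : Real.sqrt (b^2-1^2) ≤ Real.sqrt (y^2-1^2) := Real.sqrt_le_sqrt (by nlinarith)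
  unfold Rr
  gcongr

lemma sigmaF_eq (y t : ℝ) (ht : 0 < t) (h : sigmaF y = t) : psi 1 y = π/t := by
  have e : sigmaF y = π / psi 1 y := by unfold sigmaF psi; simp
  rw [e] at h
  have hne : psi 1 y ≠ 0 := by
    intro h0
    rw [h0] at h
    simp at h
    linarith
  rw [← h]
  have := Real.pi_pos
  field_simp

lemma psi_mvt (b Y F : ℝ) (hb : 1 < b) (hY : b ≤ Y) (hF : b ≤ F) :
    ∃ ξ, b ≤ ξ ∧ |F - ξ| ≤ |F - Y| ∧
      psi 1 F - psi 1 Y = Real.sqrt (ξ^2-1^2)/ξ * (F - Y) := by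
  have hd : ∀ s, b ≤ s → HasDerivAt (psi 1) (Real.sqrt (s^2-1^2)/s) s :=
    fun s hs => psi_deriv 1 s one_pos (hb.trans_le hs)
  rcases lt_trichotomy Y F with h | h | h
  · obtain ⟨ξ, hξ, he⟩ := exists_hasDerivAt_eq_slope (psi 1) (fun s => Real.sqrt (s^2-1^2)/s) h
      (fun s hs => (hd s (hY.trans hs.1)).continuousAt.continuousWithinAt)
      (fun s hs => hd s (hY.trans hs.1.le))
    refine ⟨ξ, hY.trans hξ.1.le, ?_, ?_⟩
    · rw [abs_of_pos (by linarith [hξ.2]), abs_of_pos (by linarith)]; linarith [hξ.1]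
    · rw [he]
      have : F - Y ≠ 0 := by linarith
      field_simp
  · exact ⟨F, hF, by simp, by simp [h]⟩
  · obtain ⟨ξ, hξ, he⟩ := exists_hasDerivAt_eq_slope (psi 1) (fun s => Real.sqrt (s^2-1^2)/s) h
      (fun s hs => (hd s (hF.trans hs.1)).continuousAt.continuousWithinAt)
      (fun s hs => hd s (hF.trans hs.1.le))
    refine ⟨ξ, hF.trans hξ.1.le, ?_, ?_⟩
    · rw [abs_of_neg (by linarith [hξ.1]), abs_of_neg (by linarith)]; linarith [hξ.2]
    · rw [he]
      have : Y - F ≠ 0 := by linarith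
      field_simp
      ring

lemma p_sq (y : ℝ) (hy : 1 < y) : 0 < Real.sqrt (y^2-1^2)/y ∧
    (Real.sqrt (y^2-1^2)/y)^2 = 1 - 1/y^2 := by
  have h1 : 0 < y^2-1^2 := by nlinarith
  have h0 : 0 < y := by linarith
  refine ⟨div_pos (Real.sqrt_pos.2 h1) h0, ?_⟩
  rw [div_pow, Real.sq_sqrt h1.le]
  field_simp

lemma p_mono (b y : ℝ) (hb : 1 < b) (hy : b ≤ y) :
    Real.sqrt (b^2-1^2)/b ≤ Real.sqrt (y^2-1^2)/y := by
  obtain ⟨h1, h2⟩ := p_sq b hb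
  obtain ⟨h3, h4⟩ := p_sq y (hb.trans_le hy)
  refine (sq_le_sq₀ h1.le h3.le).1 ?_
  rw [h2, h4]
  have : 1/y^2 ≤ 1/b^2 := by
    have : 0 < b := by linarith
    gcongr
  linarith

lemma p_lip (b y z : ℝ) (hb : 1 < b) (hy : b ≤ y) (hz : b ≤ z) :
    |Real.sqrt (y^2-1^2)/y - Real.sqrt (z^2-1^2)/z| * (Real.sqrt (b^2-1^2)/b) ≤ |y - z| := by
  have hy1 : 1 < y := hb.trans_le hy
  have hz1 : 1 < z := hb.trans_le hz
  obtain ⟨h1, h2⟩ := p_sq b hb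
  obtain ⟨h3, h4⟩ := p_sq y hy1
  obtain ⟨h5, h6⟩ := p_sq z hz1
  have h7 := p_mono b y hb hy
  have h8 := p_mono b z hb hz
  generalize Real.sqrt (b^2-1^2)/b = pb at *
  generalize Real.sqrt (y^2-1^2)/y = py at *
  generalize Real.sqrt (z^2-1^2)/z = pz at *
  have e : (py - pz)*(py+pz) = (y - z) * ((y+z)/(y^2*z^2)) := by
    have : (py - pz)*(py+pz) = 1/z^2 - 1/y^2 := by linear_combination h4 - h6
    rw [this]
    field_simp
    ring
  have h9 : (y+z)/(y^2*z^2) ≤ 2 := by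
    rw [div_le_iff₀ (by positivity)]
    have : 1 ≤ y*z := by nlinarith
    have a1 : y + z ≤ 2*(y*z) := by nlinarith [mul_nonneg (sub_nonneg.2 hy1.le) (sub_nonneg.2 hz1.le)]
    nlinarith
  have h10 : 0 ≤ (y+z)/(y^2*z^2) := by positivity
  have e2 : |py - pz| * (py+pz) = |y-z| * ((y+z)/(y^2*z^2)) := by
    rw [← abs_of_pos (show 0 < py+pz by linarith), ← abs_mul, e, abs_mul, abs_of_nonneg h10]
  have h11 : |py - pz| * (2*pb) ≤ |py-pz| * (py+pz) := by gcongr; linarith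
  have h12 : |y-z| * ((y+z)/(y^2*z^2)) ≤ |y-z| * 2 := by gcongr
  nlinarith

lemma inv_est (b Y F m ε R : ℝ) (hb : 1 < b) (hY : b ≤ Y) (hF : b ≤ F)
    (hD : psi 1 F - psi 1 Y = m - ε) (hm : 0 ≤ m) (hε : 0 ≤ ε) (hεR : ε ≤ R) :
    |(F - Y) - m * (F / Real.sqrt (F^2-1))| ≤
      (m + R)^2 / (Real.sqrt (b^2-1^2)/b)^4 + R / (Real.sqrt (b^2-1^2)/b) := by
  obtain ⟨ξ, hξb, hξ, he⟩ := psi_mvt b Y F hb hY hF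
  have hl := p_lip b F ξ hb hF hξb
  obtain ⟨h1, -⟩ := p_sq b hb
  have h7 := p_mono b F hb hF
  have h8 := p_mono b ξ hb hξb
  have e1 : F / Real.sqrt (F^2-1) = 1/(Real.sqrt (F^2-1^2)/F) := by
    rw [one_div_div, one_pow]
  rw [e1]
  rw [hD] at he
  generalize Real.sqrt (b^2-1^2)/b = pb at *
  generalize Real.sqrt (F^2-1^2)/F = pF at *
  generalize Real.sqrt (ξ^2-1^2)/ξ = px at *
  have hpF : 0 < pF := by linarith
  have hpx : 0 < px := by linarith
  have hDabs : |m - ε| ≤ m + R := by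
    rw [abs_le]; constructor <;> linarith
  have hFY : |F - Y| ≤ (m+R)/pb := by
    rw [le_div_iff₀ h1]
    have : |px * (F-Y)| = px * |F-Y| := by rw [abs_mul, abs_of_pos hpx]
    rw [← he] at this
    nlinarith [abs_nonneg (F-Y)]
  have hpd : |pF - px| ≤ (m+R)/pb^2 := by
    rw [le_div_iff₀ (by positivity)]
    have : |pF - px| * pb ≤ (m+R)/pb := hl.trans (hξ.trans hFY)
    rw [le_div_iff₀ h1] at this
    nlinarith
  have e2 : (F - Y) - m * (1/pF) = (m - ε) * ((pF - px)/(pF*px)) - ε/pF := by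
    have : F - Y = (m-ε)/px := by rw [he]; field_simp
    rw [this]
    field_simp
    ring
  rw [e2]
  refine (abs_sub _ _).trans ?_
  rw [abs_mul, abs_div, abs_of_pos (mul_pos hpF hpx), abs_of_nonneg (div_nonneg hε hpF.le)]
  have hmR : 0 ≤ m + R := by linarith
  have b1 : |pF - px|/(pF*px) ≤ ((m+R)/pb^2)/(pb*pb) := by gcongr
  have b2 : |m-ε| * (|pF - px|/(pF*px)) ≤ (m+R) * (((m+R)/pb^2)/(pb*pb)) := by gcongr
  have b3 : (m+R) * (((m+R)/pb^2)/(pb*pb)) = (m+R)^2/pb^4 := by field_simp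
  have b4 : ε/pF ≤ R/pb := by
    have : 0 ≤ R := hε.trans hεR
    gcongr
  linarith

set_option maxHeartbeats 1000000

theorem stmt_7 (x : ℝ) (hx : 0 < x)
    (J : ℝ → ℕ → ℝ)
    (hJpos : ∀ ν : ℝ, 0 ≤ ν → ∀ k : ℕ, 1 ≤ k → 0 < J ν k)
    (hJmono : ∀ ν : ℝ, 0 ≤ ν → ∀ k l : ℕ, 1 ≤ k → k < l → J ν k < J ν l)
    (hJzero : ∀ ν : ℝ, 0 ≤ ν → ∀ k : ℕ, 1 ≤ k → besselJ ν (J ν k) = 0)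
    (hJall : ∀ ν : ℝ, 0 ≤ ν → ∀ z : ℝ, 0 < z → besselJ ν z = 0 →
      ∃ k : ℕ, 1 ≤ k ∧ J ν k = z)
    (f : ℝ → ℝ) (hf : ∀ t : ℝ, 0 < t → 1 < f t ∧ sigmaF (f t) = t) :
    ∃ C : ℝ, 0 < C ∧ ∃ k₀ : ℕ, 1 ≤ k₀ ∧ ∀ k : ℕ, k₀ ≤ k →
      -(Real.pi/(4*k)) * (f x / Real.sqrt ((f x)^2 - 1)) - C/(k:ℝ)^2
          ≤ J (x*k) k / k - x * f x ∧
        J (x*k) k / k - x * f x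
          ≤ -(Real.pi/(4*k)) * (f x / Real.sqrt ((f x)^2 - 1)) + C/(k:ℝ)^2 := by
  obtain ⟨hF1, hFs⟩ := hf x hx
  obtain ⟨hb1, hbs⟩ := hf (2*x) (by positivity)
  have hFpsi := sigmaF_eq _ _ hx hFs
  have hbpsi := sigmaF_eq _ _ (by positivity) hbs
  generalize f x = F at *
  generalize f (2*x) = b at *
  have hπ := Real.pi_pos
  have hle : ∀ Y, 1 < Y → π/(2*x) ≤ psi 1 Y → b ≤ Y := by
    intro Y hY h
    rw [← hbpsi] at h
    exact ((psi_mono 1 one_pos).le_iff_le hb1 hY).1 h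
  have hbF : b ≤ F := by
    apply hle F hF1
    rw [hFpsi]
    gcongr
    linarith
  set pb := Real.sqrt (b^2-1^2)/b with hpb
  have hpbp : 0 < pb := (p_sq b hb1).1
  set R0 := Rr 1 b with hR0
  have hR0p : 0 < R0 := Rr_pos 1 b one_pos hb1
  refine ⟨x * ((π/(4*x) + R0/x^2)^2/pb^4 + R0/x^2/pb), by positivity, ⌈1/x⌉₊ + 1, by omega, ?_⟩
  intro k hk
  have hk1 : 1 ≤ k := by omega
  have hkr1 : (1:ℝ) ≤ k := by exact_mod_cast hk1
  have hkx : 1 ≤ x * k := by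
    have h1 : 1/x ≤ (⌈1/x⌉₊ : ℝ) := Nat.le_ceil _
    have h2 : ((⌈1/x⌉₊ + 1 : ℕ) : ℝ) ≤ k := by exact_mod_cast hk
    push_cast at h2
    have : 1/x ≤ k := by linarith
    rw [div_le_iff₀ hx] at this
    linarith
  have hkp : (0:ℝ) < k := by linarith
  have hν : 0 < x * k := by linarith
  obtain ⟨z1, z2, z3⟩ := zero_bound (x*k) hkx (J (x*k)) (hJpos _ hν.le) (hJmono _ hν.le)
    (fun i hi => (besselJ_zero_iff (x*k) _ (hJpos _ hν.le i hi)).1 (hJzero _ hν.le i hi))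
    (fun z hz h0 => hJall _ hν.le z hz ((besselJ_zero_iff (x*k) z hz).2 h0)) k hk1
  obtain ⟨Y, hY⟩ : ∃ Y, J (x*k) k = x*k*Y := ⟨J (x*k) k/(x*k), by field_simp⟩
  rw [hY] at z1 z2 z3 ⊢
  rw [psi_scale _ _ hν] at z2 z3
  rw [Rr_scale _ _ hν] at z3
  have hY1 : 1 < Y := by
    by_contra hc
    push Not at hc
    nlinarith
  have hbY : b ≤ Y := by
    apply hle Y hY1
    rw [div_le_iff₀ (by positivity)]
    have : (k:ℝ)*π ≤ k * (psi 1 Y * (2*x)) := by nlinarith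
    exact le_of_mul_le_mul_left this hkp
  have hRY := Rr_anti b Y hb1 hbY
  have est := inv_est b Y F (π/(4*(x*k))) (π/(4*(x*k)) - (psi 1 F - psi 1 Y)) (R0/x^2/k^2)
    hb1 hbY hbF (by ring) (by positivity) (by
      rw [hFpsi, ← mul_le_mul_iff_right₀ hν]
      have : x*k*(π/(4*(x*k)) - (π/x - psi 1 Y)) = π/4 - k*π + x*k*psi 1 Y := by
        field_simp
        ring
      rw [this]; linarith) (by
      rw [hFpsi, ← mul_le_mul_iff_right₀ hν]
      have : x*k*(π/(4*(x*k)) - (π/x - psi 1 Y)) = π/4 - k*π + x*k*psi 1 Y := by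
        field_simp
        ring
      rw [this]
      have e : x*k*(R0/x^2/k^2) = R0/(x*k) := by field_simp
      rw [e]
      have : Rr 1 Y/(x*k) ≤ R0/(x*k) := by gcongr
      linarith)
  rw [← hpb] at est
  have hbd : (π/(4*(x*k)) + R0/x^2/k^2)^2/pb^4 + R0/x^2/k^2/pb
      ≤ ((π/(4*x) + R0/x^2)^2/pb^4 + R0/x^2/pb)/k^2 := by
    have h1 : π/(4*(x*k)) + R0/x^2/k^2 ≤ (π/(4*x) + R0/x^2)/k := by
      have e1 : π/(4*(x*k)) = π/(4*x)/k := by field_simp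
      have e2 : R0/x^2/(k:ℝ)^2 ≤ R0/x^2/k := by
        gcongr
        nlinarith
      rw [e1, add_div]
      linarith
    have h2 : (π/(4*(x*k)) + R0/x^2/k^2)^2/pb^4 ≤ ((π/(4*x) + R0/x^2)/k)^2/pb^4 := by gcongr
    have h3 : ((π/(4*x) + R0/x^2)/k)^2/pb^4 + R0/x^2/k^2/pb
        = ((π/(4*x) + R0/x^2)^2/pb^4 + R0/x^2/pb)/k^2 := by
      field_simp
    linarith
  have est2 := est.trans hbd
  set C1 := (π/(4*x) + R0/x^2)^2/pb^4 + R0/x^2/pb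
  rw [abs_le] at est2
  obtain ⟨u1, u2⟩ := est2
  generalize F / Real.sqrt (F^2-1) = S at *
  have e1 : x*k*Y/k - x*F = -(x*(F - Y)) := by field_simp; ring
  have e2 : -(π/(4*k))*S = -(x*(π/(4*(x*k))*S)) := by field_simp
  have e3 : x*C1/(k:ℝ)^2 = x*(C1/k^2) := by ring
  rw [e1, e2, e3]
  have v1 := mul_le_mul_of_nonneg_left u1 hx.le
  have v2 := mul_le_mul_of_nonneg_left u2 hx.le
  constructor <;> linarith
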